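/- arXiv:2410.14133 — 3 statements merged into one kernel-verified Lean document; each statement's English description precedes it below -/
import Mathlib

section
/- Let a = 1/87 and δ = 85/688. Then (4δ(1−a)/(1−2a)) · log( (1−2a)/(2δ(1−a)) − 1 ) − (2δ(1−a)/(1−2a)) · ( log(1/(3δ)) − log( (1 − (2/3)·(1−a)/(1−2a)) / (1 − 2δ·(1−a)/(1−2a)) ) ) − (2δ/(1−a)) · ∫_δ^{1/3} log(2 − 3β)/(β(1 − β)) dβ > 0.0001. -/
open Set in
theorem log_upper_aux {x : ℝ} (hx : -1 < x) :
    Real.log (1 + x) ≤ x - x ^ 2 / 2 + x ^ 3 / 3 - x ^ 4 / 4 + x ^ 5 / 5 := by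
  let h : ℝ → ℝ := fun x => x - x ^ 2 / 2 + x ^ 3 / 3 - x ^ 4 / 4 + x ^ 5 / 5 - Real.log (1 + x)
  have hd : ∀ y : ℝ, -1 < y → HasDerivAt h (y ^ 5 / (1 + y)) y := by
    intro y hy
    have hne : 1 + y ≠ 0 := by linarith
    have h1 := (((((hasDerivAt_id y).sub ((hasDerivAt_pow 2 y).div_const 2)).add
      ((hasDerivAt_pow 3 y).div_const 3)).sub ((hasDerivAt_pow 4 y).div_const 4)).add
      ((hasDerivAt_pow 5 y).div_const 5)).sub (((hasDerivAt_id y).const_add 1).log hne)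
    refine h1.congr_deriv ?_
    simp only [id]
    field_simp
    ring
  have h0 : h 0 = 0 := by simp [h]
  suffices h 0 ≤ h x by
    rw [h0] at this
    simpa [h] using this
  rcases le_total 0 x with h0x | hx0
  · have : MonotoneOn h (Icc 0 x) := by
      refine monotoneOn_of_hasDerivWithinAt_nonneg (f' := fun y => y ^ 5 / (1 + y)) (convex_Icc 0 x)
        (fun y hy => (hd y (by linarith [hy.1])).continuousAt.continuousWithinAt) ?_ ?_
      · intro y hy
        rw [interior_Icc] at hy
        exact (hd y (by linarith [hy.1])).hasDerivWithinAt
      · intro y hy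
        rw [interior_Icc] at hy
        have := hy.1
        positivity
    exact this ⟨le_rfl, h0x⟩ ⟨h0x, le_rfl⟩ h0x
  · have : AntitoneOn h (Icc x 0) := by
      refine antitoneOn_of_hasDerivWithinAt_nonpos (f' := fun y => y ^ 5 / (1 + y)) (convex_Icc x 0)
        (fun y hy => (hd y (by linarith [hy.1])).continuousAt.continuousWithinAt) ?_ ?_
      · intro y hy
        rw [interior_Icc] at hy
        exact (hd y (by linarith [hy.1])).hasDerivWithinAt
      · intro y hy
        rw [interior_Icc] at hy
        have h1 := hy.1
        have h2 := hy.2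
        apply div_nonpos_of_nonpos_of_nonneg
        · exact (Odd.pow_nonpos_iff (by decide)).2 h2.le
        · linarith
    exact this ⟨le_rfl, hx0⟩ ⟨hx0, le_rfl⟩ hx0

theorem integral_aux :
    ∫ β in (85 / 688 : ℝ)..(1 / 3 : ℝ), Real.log (2 - 3 * β) / (β * (1 - β)) ≤
      (Real.log (4 / 3) + 391 / 960) * (Real.log (1 / 3) - Real.log (85 / 688))
      - (Real.log (4 / 3) - 41069 / 3840) * (Real.log (2 / 3) - Real.log (603 / 688))
      + (12231 / 1280 * (1 / 3 - 85 / 688) + 11421 / 2560 * ((1 / 3) ^ 2 - (85 / 688) ^ 2)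
        + 2187 / 1280 * ((1 / 3) ^ 3 - (85 / 688) ^ 3)
        + 59049 / 20480 * ((1 / 3) ^ 4 - (85 / 688) ^ 4)) := by
  set L := Real.log (4 / 3) with hL
  let g : ℝ → ℝ := fun β => (L + 391 / 960) * β⁻¹ + (L - 41069 / 3840) * (1 - β)⁻¹
    + (12231 / 1280 + 11421 / 1280 * β + 6561 / 1280 * β ^ 2 + 59049 / 5120 * β ^ 3)
  let G : ℝ → ℝ := fun β => (L + 391 / 960) * Real.log β - (L - 41069 / 3840) * Real.log (1 - β)
    + (12231 / 1280 * β + 11421 / 2560 * β ^ 2 + 2187 / 1280 * β ^ 3 + 59049 / 20480 * β ^ 4)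
  have hle : (85 / 688 : ℝ) ≤ 1 / 3 := by norm_num
  have hgc : ContinuousOn g (Set.uIcc (85 / 688) (1 / 3)) := by
    rw [Set.uIcc_of_le hle]
    have h1 : ∀ x ∈ Set.Icc (85 / 688 : ℝ) (1 / 3), x ≠ 0 := fun x hx => by
      have := hx.1; intro h; rw [h] at this; norm_num at this
    have h2 : ∀ x ∈ Set.Icc (85 / 688 : ℝ) (1 / 3), 1 - x ≠ 0 := fun x hx => by
      have := hx.2; intro h; linarith
    exact ((continuousOn_const.mul (continuousOn_id.inv₀ h1)).add
      (continuousOn_const.mul ((continuousOn_const.sub continuousOn_id).inv₀ h2))).add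
      (by fun_prop)
  have hfc : ContinuousOn (fun β : ℝ => Real.log (2 - 3 * β) / (β * (1 - β)))
      (Set.uIcc (85 / 688) (1 / 3)) := by
    rw [Set.uIcc_of_le hle]
    refine ContinuousOn.div (ContinuousOn.log (by fun_prop) ?_) (by fun_prop) ?_
    · intro x hx
      have := hx.2
      intro h; linarith
    · intro x hx
      have h1 := hx.1
      have h2 := hx.2
      have h3 : 0 < x := by linarith
      have h4 : 0 < 1 - x := by linarith
      positivity
  have hG : ∫ β in (85 / 688 : ℝ)..(1 / 3 : ℝ), g β = G (1 / 3) - G (85 / 688) := by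
    refine intervalIntegral.integral_eq_sub_of_hasDerivAt ?_ hgc.intervalIntegrable
    intro x hx
    rw [Set.uIcc_of_le hle] at hx
    have h1 := hx.1
    have h2 := hx.2
    have h3 : x ≠ 0 := by linarith
    have h4 : 1 - x ≠ 0 := by linarith
    have hh := (((Real.hasDerivAt_log h3).const_mul (L + 391 / 960)).sub
      ((((hasDerivAt_id x).const_sub 1).log h4).const_mul (L - 41069 / 3840))).add
      (((((hasDerivAt_id x).const_mul (12231 / 1280)).add
        ((hasDerivAt_pow 2 x).const_mul (11421 / 2560))).add
        ((hasDerivAt_pow 3 x).const_mul (2187 / 1280))).add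
        ((hasDerivAt_pow 4 x).const_mul (59049 / 20480)))
    refine hh.congr_deriv ?_
    simp only [g, id]
    field_simp
    ring
  have hmono : ∫ β in (85 / 688 : ℝ)..(1 / 3 : ℝ), Real.log (2 - 3 * β) / (β * (1 - β)) ≤
      ∫ β in (85 / 688 : ℝ)..(1 / 3 : ℝ), g β := by
    refine intervalIntegral.integral_mono_on hle hfc.intervalIntegrable hgc.intervalIntegrable ?_
    intro x hx
    have h1 := hx.1
    have h2 := hx.2
    have h3 : 0 < x := by linarith
    have h4 : 0 < 1 - x := by linarith
    have hu := log_upper_aux (x := 1 / 2 - 9 / 4 * x) (by linarith)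
    have hs : Real.log (2 - 3 * x) = L + Real.log (1 + (1 / 2 - 9 / 4 * x)) := by
      rw [hL, ← Real.log_mul (by norm_num) (by linarith)]
      congr 1; ring
    rw [div_le_iff₀ (by positivity), hs]
    refine (add_le_add_right hu L).trans (le_of_eq ?_)
    simp only [g]
    field_simp
    ring
  refine (hmono.trans_eq hG).trans (le_of_eq ?_)
  simp only [G]
  norm_num
  ring

theorem log_hi_aux (x y u : ℝ) (n : ℕ) (h0 : 0 ≤ x) (h1 : x < 1) (hy : (1 + x) / (1 - x) = y)
    (hu : 2 * ((∑ i ∈ Finset.range n, x ^ (2 * i + 1) / (2 * i + 1))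
      + x ^ (2 * n + 1) / (1 - x ^ 2)) ≤ u) : Real.log y ≤ u := by
  have := Real.log_div_le_sum_range_add h0 h1 n
  rw [hy] at this
  linarith

theorem log_lo_aux (x y u : ℝ) (n : ℕ) (h0 : 0 ≤ x) (h1 : x < 1) (hy : (1 + x) / (1 - x) = y)
    (hu : u ≤ 2 * (∑ i ∈ Finset.range n, x ^ (2 * i + 1) / (2 * i + 1))) : u ≤ Real.log y := by
  have := Real.sum_range_le_log_div h0 h1 n
  rw [hy] at this
  linarith

theorem stmt13 (a δ : ℝ) (ha : a = 1 / 87) (hδ : δ = 85 / 688) :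
    (4 * δ * (1 - a) / (1 - 2 * a)) *
        Real.log ((1 - 2 * a) / (2 * δ * (1 - a)) - 1) -
      (2 * δ * (1 - a) / (1 - 2 * a)) *
        (Real.log (1 / (3 * δ)) -
          Real.log ((1 - (2 / 3) * ((1 - a) / (1 - 2 * a))) /
            (1 - 2 * δ * ((1 - a) / (1 - 2 * a))))) -
      (2 * δ / (1 - a)) *
        ∫ β in δ..(1 / 3 : ℝ), Real.log (2 - 3 * β) / (β * (1 - β))
    > 0.0001 := by
  subst ha hδ
  have hI := integral_aux
  set I := ∫ β in (85 / 688 : ℝ)..(1 / 3 : ℝ), Real.log (2 - 3 * β) / (β * (1 - β)) with hIdef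
  have e1 : (1 - 2 * (1 / 87 : ℝ)) / (2 * (85 / 688) * (1 - 1 / 87)) - 1 = 3 := by norm_num
  have e2 : Real.log (1 / (3 * (85 / 688))) -
          Real.log ((1 - (2 / 3) * ((1 - 1 / 87) / (1 - 2 * (1 / 87)))) /
            (1 - 2 * (85 / 688) * ((1 - 1 / 87) / (1 - 2 * (1 / 87))))) =
      Real.log 2 + Real.log 3 + Real.log (86 / 83) := by
    rw [← Real.log_div (by norm_num) (by norm_num), ← Real.log_mul (by norm_num) (by norm_num),
      ← Real.log_mul (by norm_num) (by norm_num)]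
    norm_num
  have e3 : Real.log (1 / 3) - Real.log (85 / 688)
      = 3 * Real.log 2 - Real.log 3 + Real.log (86 / 85) := by
    have : Real.log 8 = 3 * Real.log 2 := by
      rw [show (8 : ℝ) = 2 ^ 3 by norm_num, Real.log_pow]; norm_num
    rw [← this, ← Real.log_div (by norm_num) (by norm_num),
      ← Real.log_div (by norm_num) (by norm_num), ← Real.log_mul (by norm_num) (by norm_num)]
    norm_num
  have e4 : Real.log (2 / 3) - Real.log (603 / 688) = -Real.log (1809 / 1376) := by
    rw [← Real.log_div (by norm_num) (by norm_num), ← Real.log_inv]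
    norm_num
  rw [e3, e4] at hI
  rw [e1, e2]
  have l2l := Real.log_two_gt_d9
  have l2u := Real.log_two_lt_d9
  have l3l := Real.log_three_gt_d9
  have l3u := Real.log_three_lt_d9
  have b1 : Real.log (86 / 83) ≤ 0.0355066887 :=
    log_hi_aux (3 / 169) _ _ 4 (by norm_num) (by norm_num) (by norm_num)
      (by norm_num [Finset.sum_range_succ])
  have b2 : Real.log (86 / 85) ≤ 0.0116960399 :=
    log_hi_aux (1 / 171) _ _ 4 (by norm_num) (by norm_num) (by norm_num)
      (by norm_num [Finset.sum_range_succ])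
  have b3 : Real.log (4 / 3) ≤ 0.2876820726 :=
    log_hi_aux (1 / 7) _ _ 6 (by norm_num) (by norm_num) (by norm_num)
      (by norm_num [Finset.sum_range_succ])
  have b3' : 0 ≤ Real.log (4 / 3) := Real.log_nonneg (by norm_num)
  have b4 : 0.2735934668 ≤ Real.log (1809 / 1376) :=
    log_lo_aux (433 / 3185) _ _ 6 (by norm_num) (by norm_num) (by norm_num)
      (by norm_num [Finset.sum_range_succ])
  set L := Real.log (4 / 3)
  have k1 : 3 * Real.log 2 - Real.log 3 + Real.log (86 / 85) ≤ 0.992525295 := by linarith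
  have m1 : (L + 391 / 960) * (3 * Real.log 2 - Real.log 3 + Real.log (86 / 85)) ≤
      (0.2876820726 + 391 / 960) * 0.992525295 := by
    calc _ ≤ (L + 391 / 960) * 0.992525295 :=
          mul_le_mul_of_nonneg_left k1 (by linarith)
      _ ≤ _ := mul_le_mul_of_nonneg_right (by linarith) (by norm_num)
  have m2 : (41069 / 3840 - 0.2876820726) * 0.2735934668 ≤
      (41069 / 3840 - L) * Real.log (1809 / 1376) := by
    apply mul_le_mul (by linarith) b4 (by norm_num) (by linarith)
  have hI2 : I ≤ 0.3696 := by
    norm_num at hI m1 m2 ⊢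
    linarith
  norm_num at hI2 b1 l2u l3l l3u ⊢
  linarith
end

section
/- Let b > 0 be an odd integer. Then lim_{z → ∞} (log z) · ∏_{q < z, q prime, q ∤ 2b} (1 − 1/(q − 1)) = 2·e^{−γ} · ∏_{2 < p ∣ b} (p−1)/(p−2) · ∏_{p > 2} (1 − 1/(p−1)²), where the first product in the limit runs over odd primes q < z not dividing b, the product ∏_{2<p∣b}(p−1)/(p−2) runs over odd primes dividing b, and ∏_{p>2}(1 − 1/(p−1)²) runs over all odd primes. -/
/-- The product over all odd primes `p` of `1 - 1/(p-1)^2`. -/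
noncomputable def prodOddPrimes : ℝ :=
  ∏' p : {p : ℕ // p.Prime ∧ 2 < p}, (1 - 1 / (((p : ℕ) : ℝ) - 1) ^ 2)

/-- The product over odd primes dividing `b` of `(p-1)/(p-2)`. -/
noncomputable def prodOddPrimesDvd (b : ℕ) : ℝ :=
  ∏ p ∈ b.primeFactors.filter (fun p => 2 < p), (((p : ℝ) - 1) / ((p : ℝ) - 2))

open scoped Classical in
/-- `V b z = ∏_{q < z, q prime, q ∤ 2b} (1 - 1/(q-1))`. -/
noncomputable def V (b : ℕ) (z : ℝ) : ℝ :=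
  ∏ q ∈ (Finset.range (Nat.ceil z + 1)).filter
      (fun q : ℕ => q.Prime ∧ (q : ℝ) < z ∧ ¬ q ∣ 2 * b),
    (1 - 1 / ((q : ℝ) - 1))

open Filter Topology

lemma log_fact_eq (N : ℕ) : Real.log (N.factorial : ℝ) =
    ∑ p ∈ (Finset.Ioc 0 N).filter Nat.Prime, (N.factorial.factorization p : ℝ) * Real.log p := by
  have h := Nat.prod_factorization_pow_eq_self (Nat.factorial_ne_zero N)
  have h2 : (N.factorial : ℝ) = ∏ p ∈ (Finset.Ioc 0 N).filter Nat.Prime,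
      (p : ℝ) ^ (N.factorial.factorization p) := by
    conv_lhs => rw [← h]
    rw [Finsupp.prod_of_support_subset (s := (Finset.Ioc 0 N).filter Nat.Prime)]
    · push_cast; rfl
    · intro p hp
      rw [Nat.support_factorization, Nat.mem_primeFactors] at hp
      simp only [Finset.mem_filter, Finset.mem_Ioc]
      exact ⟨⟨hp.1.pos, (hp.1.dvd_factorial).1 hp.2.1⟩, hp.1⟩
    · simp
  rw [h2, Real.log_prod]
  · refine Finset.sum_congr rfl fun p _ => ?_
    rw [Real.log_pow]
  · intro p hp
    simp only [Finset.mem_filter, Finset.mem_Ioc] at hp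
    have := hp.2.pos
    positivity

lemma mertens_upper (N : ℕ) (hN : 1 ≤ N) :
    ∑ p ∈ (Finset.Ioc 0 N).filter Nat.Prime, Real.log p / p ≤ Real.log N + Real.log 4 := by
  have hN0 : (0:ℝ) < N := by exact_mod_cast hN
  have h1 : Real.log (N.factorial : ℝ) ≤ N * Real.log N := by
    rw [← Real.log_pow]
    apply Real.log_le_log (by exact_mod_cast N.factorial_pos)
    exact_mod_cast Nat.factorial_le_pow N
  have h2 := Chebyshev.theta_le_log4_mul_x (x := (N:ℝ)) hN0.le
  rw [Chebyshev.theta, Nat.floor_natCast] at h2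
  have h3 : N * ∑ p ∈ (Finset.Ioc 0 N).filter Nat.Prime, Real.log p / p
      - ∑ p ∈ (Finset.Ioc 0 N).filter Nat.Prime, Real.log p ≤ Real.log (N.factorial : ℝ) := by
    rw [log_fact_eq, Finset.mul_sum, ← Finset.sum_sub_distrib]
    refine Finset.sum_le_sum fun p hp => ?_
    simp only [Finset.mem_filter, Finset.mem_Ioc] at hp
    have hp0 : (0:ℝ) < p := by exact_mod_cast hp.2.pos
    have hl : 0 ≤ Real.log p := Real.log_natCast_nonneg p
    have hv : N / p ≤ N.factorial.factorization p := by
      rw [Nat.factorization_factorial hp.2 (Nat.lt_succ_self _)]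
      have : 1 ∈ Finset.Ico 1 (Nat.log p N).succ := by
        simp only [Finset.mem_Ico, le_refl, true_and]
        have := Nat.log_pos hp.2.one_lt hp.1.2
        omega
      simpa using Finset.single_le_sum (f := fun i => N / p ^ i) (fun i _ => Nat.zero_le _) this
    have hv2 : (N:ℝ) / p - 1 ≤ N.factorial.factorization p := by
      have h5 : (N:ℝ)/p < (N / p : ℕ) + 1 := by
        rw [div_lt_iff₀ hp0]
        exact_mod_cast Nat.lt_mul_of_div_lt (Nat.lt_succ_self (N / p)) hp.2.pos
      have h6 : ((N / p : ℕ) : ℝ) ≤ N.factorial.factorization p := by exact_mod_cast hv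
      linarith
    calc _ = ((N:ℝ) / p - 1) * Real.log p := by ring
      _ ≤ _ := mul_le_mul_of_nonneg_right hv2 hl
  have : N * ∑ p ∈ (Finset.Ioc 0 N).filter Nat.Prime, Real.log p / p
    ≤ N * (Real.log N + Real.log 4) := by linarith
  exact le_of_mul_le_mul_left this hN0

lemma summable_log_aux : Summable (fun n : ℕ => Real.log n / (n * ((n:ℝ) - 1))) := by
  have hs : Summable (fun n : ℕ => 4 * (1 / (n:ℝ) ^ (3/2 : ℝ))) :=
    (Real.summable_one_div_nat_rpow.2 (by norm_num)).mul_left _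
  refine Summable.of_nonneg_of_le (fun n => ?_) (fun n => ?_) hs
  · rcases Nat.eq_zero_or_pos n with rfl | h
    · simp
    · have : (1:ℝ) ≤ n := by exact_mod_cast h
      exact div_nonneg (Real.log_nonneg this) (mul_nonneg (by linarith) (by linarith))
  · rcases lt_or_ge n 2 with h | h
    · interval_cases n <;> simp
    · have hn : (2:ℝ) ≤ n := by exact_mod_cast h
      have hn0 : (0:ℝ) < n := by linarith
      have h1 : Real.log n ≤ 2 * (n:ℝ) ^ (1/2:ℝ) := by
        have := Real.log_le_rpow_div hn0.le (show (0:ℝ) < 1/2 by norm_num)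
        linarith
      have h2 : (n:ℝ) ^ (1/2:ℝ) * (n:ℝ) ^ (3/2:ℝ) = n ^ 2 := by
        rw [← Real.rpow_add hn0]; norm_num
      have h3 : (0:ℝ) < (n:ℝ) ^ (3/2:ℝ) := Real.rpow_pos_of_pos hn0 _
      rw [div_le_iff₀ (by nlinarith)]
      have : 4 * (1 / (n:ℝ) ^ (3/2 : ℝ)) * (n * ((n:ℝ) - 1)) ≥ 4 * (1 / (n:ℝ) ^ (3/2 : ℝ)) * (n^2/2) := by
        gcongr; nlinarith
      have h4 : 4 * (1 / (n:ℝ) ^ (3/2 : ℝ)) * (n^2/2) = 2 * (n:ℝ) ^ (1/2:ℝ) := by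
        rw [← h2]; field_simp; norm_num
      linarith

lemma mertens_lower : ∃ K : ℝ, ∀ N : ℕ, 1 ≤ N →
    Real.log N - K ≤ ∑ p ∈ (Finset.Ioc 0 N).filter Nat.Prime, Real.log p / p := by
  refine ⟨1 + ∑' n : ℕ, Real.log n / (n * ((n:ℝ) - 1)), fun N hN => ?_⟩
  have hN0 : (0:ℝ) < N := by exact_mod_cast hN
  have h1 : N * Real.log N - N ≤ Real.log (N.factorial : ℝ) := by
    have := Stirling.le_log_factorial_stirling (n := N) (by omega)
    have h2 : 0 ≤ Real.log N := Real.log_natCast_nonneg N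
    have h3 : 0 ≤ Real.log (2 * Real.pi) := Real.log_nonneg (by nlinarith [Real.pi_gt_three])
    linarith
  have hT : ∑ p ∈ (Finset.Ioc 0 N).filter Nat.Prime, Real.log p / (p * ((p:ℝ) - 1))
      ≤ ∑' n : ℕ, Real.log n / (n * ((n:ℝ) - 1)) := by
    refine summable_log_aux.sum_le_tsum _ fun n _ => ?_
    rcases Nat.eq_zero_or_pos n with rfl | h
    · simp
    · have : (1:ℝ) ≤ n := by exact_mod_cast h
      exact div_nonneg (Real.log_nonneg this) (mul_nonneg (by linarith) (by linarith))
  have h3 : Real.log (N.factorial : ℝ) ≤ N * (∑ p ∈ (Finset.Ioc 0 N).filter Nat.Prime, Real.log p / p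
      + ∑ p ∈ (Finset.Ioc 0 N).filter Nat.Prime, Real.log p / (p * ((p:ℝ) - 1))) := by
    rw [log_fact_eq, ← Finset.sum_add_distrib, Finset.mul_sum]
    refine Finset.sum_le_sum fun p hp => ?_
    simp only [Finset.mem_filter, Finset.mem_Ioc] at hp
    have hp2 : (2:ℝ) ≤ p := by exact_mod_cast hp.2.two_le
    have hl : 0 ≤ Real.log p := Real.log_natCast_nonneg p
    have : Fact p.Prime := ⟨hp.2⟩
    have hv := sub_one_mul_padicValNat_factorial (p := p) N
    have hv2 : (p - 1) * N.factorial.factorization p ≤ N := by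
      rw [Nat.factorization_def _ hp.2, hv]; omega
    have hv3 : ((p:ℝ) - 1) * N.factorial.factorization p ≤ N := by
      have : (((p - 1 : ℕ) : ℝ)) * N.factorial.factorization p ≤ N := by exact_mod_cast hv2
      rwa [Nat.cast_sub hp.2.one_le, Nat.cast_one] at this
    have hv4 : (N.factorial.factorization p : ℝ) ≤ N / ((p:ℝ) - 1) := by
      rw [le_div_iff₀ (by linarith)]; linarith
    have h5 : (p:ℝ) - 1 ≠ 0 := by linarith
    have h6 : (p:ℝ) ≠ 0 := by linarith
    calc _ ≤ N / ((p:ℝ) - 1) * Real.log p := mul_le_mul_of_nonneg_right hv4 hl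
      _ = _ := by field_simp; ring
  have : N * (Real.log N - 1) ≤ N * (∑ p ∈ (Finset.Ioc 0 N).filter Nat.Prime, Real.log p / p
      + ∑ p ∈ (Finset.Ioc 0 N).filter Nat.Prime, Real.log p / (p * ((p:ℝ) - 1))) := by linarith
  have := le_of_mul_le_mul_left this hN0
  linarith

/-- the prime indicator weight -/
noncomputable def cP (n : ℕ) : ℝ := if n.Prime then 1 / (n : ℝ) else 0

lemma G_conv : ∃ g : ℝ, Tendsto (fun n : ℕ => ∑ i ∈ Finset.range (n+1),
    (Real.log ((i:ℝ)+2) - Real.log ((i:ℝ)+1)) / Real.log ((i:ℝ)+2) - Real.log (Real.log ((n:ℝ)+2)))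
    atTop (𝓝 g) := by
  set G := (fun n : ℕ => ∑ i ∈ Finset.range (n+1),
    (Real.log ((i:ℝ)+2) - Real.log ((i:ℝ)+1)) / Real.log ((i:ℝ)+2) - Real.log (Real.log ((n:ℝ)+2)))
    with hG
  have key : ∀ n : ℕ, G (n+1) ≤ G n ∧
      G n - 1 / Real.log ((n:ℝ)+2) ≤ G (n+1) - 1 / Real.log (((n+1 : ℕ):ℝ)+2) := by
    intro n
    have hn : (0:ℝ) ≤ n := n.cast_nonneg
    have e1 : ((n+1:ℕ):ℝ) + 2 = (n:ℝ) + 3 := by push_cast; ring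
    have e2 : ((n+1:ℕ):ℝ) + 1 = (n:ℝ) + 2 := by push_cast; ring
    simp only [hG]
    rw [Finset.sum_range_succ _ (n+1), e1, e2]
    set u := Real.log ((n:ℝ)+2) with hu
    set v := Real.log ((n:ℝ)+3) with hv
    have hu0 : 0 < u := Real.log_pos (by linarith)
    have huv : u ≤ v := Real.log_le_log (by linarith) (by linarith)
    have hv0 : 0 < v := by linarith
    have hd : v - u ≤ 1 := by
      rw [hu, hv, ← Real.log_div (by linarith) (by linarith)]
      refine (Real.log_le_sub_one_of_pos (by positivity)).trans ?_
      rw [sub_le_iff_le_add, div_le_iff₀ (by linarith)]; linarith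
    have l1 : Real.log v - Real.log u ≤ v / u - 1 := by
      rw [← Real.log_div hv0.ne' hu0.ne']
      exact Real.log_le_sub_one_of_pos (by positivity)
    have l2 : Real.log u - Real.log v ≤ u / v - 1 := by
      rw [← Real.log_div hu0.ne' hv0.ne']
      exact Real.log_le_sub_one_of_pos (by positivity)
    have e3 : (v - u) / v = 1 - u / v := by field_simp
    constructor
    · rw [e3]; linarith
    · have h4 : (v - u) * (1 / u - 1 / v) ≤ 1 * (1/u - 1/v) := by
        apply mul_le_mul_of_nonneg_right hd
        rw [sub_nonneg]; exact one_div_le_one_div_of_le hu0 huv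
      have h5 : (v - u) * (1 / u - 1 / v) = (v/u - 1) - (1 - u/v) := by field_simp
      rw [e3]; linarith
  have hanti : Antitone G := antitone_nat_of_succ_le fun n => (key n).1
  have hmono : Monotone fun n : ℕ => G n - 1 / Real.log ((n:ℝ)+2) :=
    monotone_nat_of_le_succ fun n => (key n).2
  refine ⟨_, tendsto_atTop_ciInf hanti ⟨G 0 - 1 / Real.log (((0:ℕ):ℝ)+2), ?_⟩⟩
  rintro _ ⟨n, rfl⟩
  have h1 := hmono (Nat.zero_le n)
  have h2 : 0 ≤ 1 / Real.log ((n:ℝ)+2) := by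
    have : 0 ≤ (n:ℝ) := n.cast_nonneg
    exact one_div_nonneg.2 (Real.log_nonneg (by linarith))
  simp only at h1
  linarith

lemma mertens_two : ∃ C : ℝ, Tendsto (fun n : ℕ => ∑ i ∈ Finset.range (n+1), cP i
    - Real.log (Real.log n)) atTop (𝓝 C) := by
  obtain ⟨K, hK⟩ := mertens_lower
  obtain ⟨g, hg⟩ := G_conv
  set z : ℕ → ℝ := fun i => (if (i+2).Prime then Real.log ((i:ℝ)+2) / ((i:ℝ)+2) else 0)
    - (Real.log ((i:ℝ)+2) - Real.log ((i:ℝ)+1)) with hz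
  have hsum : ∀ n : ℕ, ∑ i ∈ Finset.range n, z i =
      ∑ p ∈ (Finset.Ioc 0 (n+1)).filter Nat.Prime, Real.log p / p - Real.log ((n+1 : ℕ):ℝ) := by
    intro n
    induction n with
    | zero => simp [Finset.filter_singleton, Nat.not_prime_one]
    | succ n ih =>
      rw [Finset.sum_range_succ, ih, Finset.sum_filter, Finset.sum_filter,
        Finset.sum_Ioc_succ_top (by omega) (b := n+1)]
      simp only [hz]
      push_cast
      have : (n:ℝ) + 1 + 1 = n + 2 := by ring
      rw [this]
      ring
  have hz_bd : ∀ n, ‖∑ i ∈ Finset.range n, z i‖ ≤ |K| + Real.log 4 := by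
    intro n
    rw [hsum, Real.norm_eq_abs, abs_le]
    have h1 := hK (n+1) (by omega)
    have h2 := mertens_upper (n+1) (by omega)
    have h3 := le_abs_self K
    have h4 : 0 ≤ Real.log 4 := Real.log_nonneg (by norm_num)
    have h5 := abs_nonneg K
    constructor <;> linarith
  have hf_anti : Antitone (fun i : ℕ => 1 / Real.log ((i:ℝ)+2)) := by
    intro i j hij
    have hi : (0:ℝ) ≤ i := i.cast_nonneg
    have : (i:ℝ) ≤ j := by exact_mod_cast hij
    exact one_div_le_one_div_of_le (Real.log_pos (by linarith))
      (Real.log_le_log (by linarith) (by linarith))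
  have hf0 : Tendsto (fun i : ℕ => 1 / Real.log ((i:ℝ)+2)) atTop (𝓝 0) := by
    simp only [one_div]
    exact tendsto_inv_atTop_zero.comp (Real.tendsto_log_atTop.comp
      (tendsto_atTop_add_const_right _ _ tendsto_natCast_atTop_atTop))
  obtain ⟨c, hc⟩ := cauchySeq_tendsto_of_complete
    (hf_anti.cauchySeq_series_mul_of_tendsto_zero_of_bounded hf0 hz_bd)
  refine ⟨c + g, ?_⟩
  have h := (hc.comp (tendsto_add_atTop_nat 1)).add hg
  rw [← tendsto_add_atTop_iff_nat 2]
  refine h.congr fun n => ?_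
  simp only [Function.comp]
  rw [Finset.sum_range_succ' cP (n+2), Finset.sum_range_succ' _ (n+1)]
  have c0 : cP 0 = 0 := by simp [cP, Nat.not_prime_zero]
  have c1 : cP (0+1) = 0 := by simp [cP, Nat.not_prime_one]
  rw [c0, c1, ← add_sub_assoc, ← Finset.sum_add_distrib]
  push_cast
  rw [add_zero, add_zero]
  congr 1
  refine Finset.sum_congr rfl fun i _ => ?_
  have hi : (0:ℝ) ≤ i := i.cast_nonneg
  have hl : Real.log ((i:ℝ)+2) ≠ 0 := (Real.log_pos (by linarith)).ne'
  simp only [hz, cP, smul_eq_mul]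
  have e : ((i + 1 + 1 : ℕ):ℝ) = i + 2 := by push_cast; ring
  rw [e]
  split_ifs with h1
  · field_simp; ring
  · field_simp; ring

lemma log_floor_sub : Tendsto (fun x : ℝ => Real.log (⌊x⌋₊ : ℝ) - Real.log x) atTop (𝓝 0) := by
  have h := (tendsto_nat_floor_div_atTop (R := ℝ)).log one_ne_zero
  rw [Real.log_one] at h
  refine h.congr' ?_
  filter_upwards [eventually_ge_atTop 1] with x hx
  have : (0:ℝ) < ⌊x⌋₊ := by exact_mod_cast Nat.floor_pos.2 hx
  rw [Real.log_div this.ne' (by linarith)]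

lemma log_log_sub_aux {f : ℝ → ℝ} (hf : Tendsto (fun x => f x - x) atTop (𝓝 0)) :
    Tendsto (fun x => Real.log (f x) - Real.log x) atTop (𝓝 0) := by
  have h1 : Tendsto (fun x => f x / x) atTop (𝓝 1) := by
    have := (hf.mul tendsto_inv_atTop_zero).add_const 1
    simp only [zero_mul, zero_add] at this
    refine this.congr' ?_
    filter_upwards [eventually_gt_atTop 0] with x hx
    field_simp; ring
  have h2 := h1.log one_ne_zero
  rw [Real.log_one] at h2
  refine h2.congr' ?_
  filter_upwards [eventually_gt_atTop 0, h1.eventually (lt_mem_nhds one_pos)] with x hx h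
  have : 0 < f x := by
    have := mul_pos h hx
    rwa [div_mul_cancel₀ _ hx.ne'] at this
  rw [Real.log_div this.ne' hx.ne']

noncomputable def BB (t : ℝ) : ℝ :=
  ∑ i ∈ Finset.range (⌊Real.exp t⌋₊+1), cP i - ∑ i ∈ Finset.range (⌊t⌋₊+1), 1 / (i:ℝ)

lemma harm_eq (n : ℕ) : ∑ i ∈ Finset.range (n+1), 1 / (i:ℝ) = (harmonic n : ℝ) := by
  rw [Finset.sum_range_succ', harmonic]
  push_cast
  simp

lemma BB_tendsto {C : ℝ} (hC : Tendsto (fun n : ℕ => ∑ i ∈ Finset.range (n+1), cP i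
    - Real.log (Real.log n)) atTop (𝓝 C)) :
    Tendsto BB atTop (𝓝 (C - Real.eulerMascheroniConstant)) := by
  have h1 := hC.comp ((tendsto_nat_floor_atTop (α := ℝ)).comp Real.tendsto_exp_atTop)
  have h2 := Real.tendsto_harmonic_sub_log.comp (tendsto_nat_floor_atTop (α := ℝ))
  have h3 : Tendsto (fun t : ℝ => Real.log (Real.log (⌊Real.exp t⌋₊ : ℝ)) - Real.log t)
      atTop (𝓝 0) := by
    apply log_log_sub_aux
    refine (log_floor_sub.comp Real.tendsto_exp_atTop).congr fun t => ?_
    simp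
  have h := ((h1.sub h2).add h3).sub log_floor_sub
  simp only [add_zero, sub_zero] at h
  refine h.congr fun t => ?_
  simp only [Function.comp, BB, harm_eq]
  ring

lemma cP_nonneg (n : ℕ) : 0 ≤ cP n := by
  unfold cP; split_ifs <;> positivity

lemma cP_le (n : ℕ) : cP n ≤ 1 / n := by
  unfold cP; split_ifs
  · exact le_rfl
  · positivity

lemma BB_bdd {L : ℝ} (h : Tendsto BB atTop (𝓝 L)) : ∃ M : ℝ, ∀ t, |BB t| ≤ M := by
  have h1 : ∀ᶠ t in atTop, |BB t| ≤ |L| + 1 :=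
    (h.abs.eventually (gt_mem_nhds (lt_add_one |L|))).mono fun t ht => ht.le
  obtain ⟨T, hT⟩ := eventually_atTop.1 h1
  refine ⟨(|L| + 1) + (∑ i ∈ Finset.range (⌊Real.exp T⌋₊+1), cP i
    + ∑ i ∈ Finset.range (⌊T⌋₊+1), 1 / (i:ℝ)), fun t => ?_⟩
  have p1 : ∀ n, 0 ≤ ∑ i ∈ Finset.range n, cP i := fun n => Finset.sum_nonneg fun i _ => cP_nonneg i
  have p2 : ∀ n, 0 ≤ ∑ i ∈ Finset.range n, 1 / (i:ℝ) := fun n => Finset.sum_nonneg fun i _ => by positivity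
  rcases le_total T t with ht | ht
  · have := hT t ht
    have := p1 (⌊Real.exp T⌋₊+1)
    have := p2 (⌊T⌋₊+1)
    linarith
  · have q1 : ∑ i ∈ Finset.range (⌊Real.exp t⌋₊+1), cP i ≤ ∑ i ∈ Finset.range (⌊Real.exp T⌋₊+1), cP i := by
      apply Finset.sum_le_sum_of_subset_of_nonneg
      · apply Finset.range_mono
        have := Nat.floor_le_floor (Real.exp_le_exp.2 ht)
        omega
      · intro i _ _; exact cP_nonneg i
    have q2 : ∑ i ∈ Finset.range (⌊t⌋₊+1), 1 / (i:ℝ) ≤ ∑ i ∈ Finset.range (⌊T⌋₊+1), 1 / (i:ℝ) := by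
      apply Finset.sum_le_sum_of_subset_of_nonneg
      · apply Finset.range_mono
        have := Nat.floor_le_floor ht
        omega
      · intro i _ _; positivity
    have := p1 (⌊Real.exp t⌋₊+1)
    have := p2 (⌊t⌋₊+1)
    have := abs_nonneg L
    unfold BB
    rw [abs_le]; constructor <;> linarith

lemma BB_meas : Measurable BB := by
  unfold BB
  apply Measurable.sub
  · exact (measurable_from_nat (f := fun n => ∑ i ∈ Finset.range (n+1), cP i)).comp
      (Nat.measurable_floor.comp Real.measurable_exp)
  · exact (measurable_from_nat (f := fun n => ∑ i ∈ Finset.range (n+1), 1 / (i:ℝ))).comp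
      Nat.measurable_floor

lemma abel_lim {L : ℝ} (h : Tendsto BB atTop (𝓝 L)) :
    Tendsto (fun δ : ℝ => ∫ u in Set.Ioi (0:ℝ), Real.exp (-u) * BB (u / δ)) (𝓝[>] 0) (𝓝 L) := by
  obtain ⟨M, hM⟩ := BB_bdd h
  have e : ∫ u in Set.Ioi (0:ℝ), Real.exp (-u) * L = L := by
    rw [MeasureTheory.integral_mul_const, integral_exp_neg_Ioi]; simp
  rw [← e]
  have hint : MeasureTheory.IntegrableOn (fun u : ℝ => Real.exp (-u)) (Set.Ioi 0) :=
    integrableOn_exp_neg_Ioi 0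
  refine MeasureTheory.tendsto_integral_filter_of_dominated_convergence
    (fun u => Real.exp (-u) * M) ?_ ?_ (hint.mul_const M) ?_
  · refine Eventually.of_forall fun δ => Measurable.aestronglyMeasurable ?_
    exact (Real.measurable_exp.comp measurable_neg).mul
      (BB_meas.comp (measurable_id.div_const δ))
  · refine Eventually.of_forall fun δ => Eventually.of_forall fun u => ?_
    rw [norm_mul, Real.norm_eq_abs, Real.norm_eq_abs, abs_of_pos (Real.exp_pos _)]
    exact mul_le_mul_of_nonneg_left (hM _) (Real.exp_pos _).le
  · rw [MeasureTheory.ae_restrict_iff' measurableSet_Ioi]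
    refine Eventually.of_forall fun u hu => ?_
    refine Tendsto.const_mul _ (h.comp ?_)
    show Tendsto (fun δ : ℝ => u * δ⁻¹) _ _
    exact (tendsto_inv_nhdsGT_zero).const_mul_atTop hu

lemma int_thresh (a : ℝ) (ha : 0 ≤ a) (c : ℝ) :
    MeasureTheory.IntegrableOn (fun u : ℝ => Real.exp (-u) * (if a ≤ u then c else 0)) (Set.Ioi 0) ∧
    ∫ u in Set.Ioi (0:ℝ), Real.exp (-u) * (if a ≤ u then c else 0) = c * Real.exp (-a) := by
  have e : (fun u : ℝ => Real.exp (-u) * (if a ≤ u then c else 0)) =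
      (Set.Ici a).indicator (fun u => Real.exp (-u) * c) := by
    ext u; simp [Set.indicator_apply]
  have hint : MeasureTheory.IntegrableOn (fun u : ℝ => Real.exp (-u)) (Set.Ioi 0) :=
    integrableOn_exp_neg_Ioi 0
  rw [e]
  constructor
  · exact MeasureTheory.Integrable.indicator (hint.mul_const c) measurableSet_Ici
  · rw [MeasureTheory.setIntegral_indicator measurableSet_Ici]
    have : (Set.Ioi (0:ℝ) ∩ Set.Ici a : Set ℝ) =ᵐ[MeasureTheory.volume] Set.Ioi a := by
      have h1 : (Set.Ioi (0:ℝ) ∩ Set.Ici a : Set ℝ) =ᵐ[MeasureTheory.volume] (Set.Ioi (0:ℝ) ∩ Set.Ioi a : Set ℝ) :=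
        (Filter.EventuallyEq.refl _ _).inter MeasureTheory.Ioi_ae_eq_Ici.symm
      rwa [Set.Ioi_inter_Ioi, max_eq_right ha] at h1
    rw [MeasureTheory.setIntegral_congr_set this, MeasureTheory.integral_mul_const,
      integral_exp_neg_Ioi, mul_comm]

lemma tonelli (δ : ℝ) (hδ : 0 < δ)
    (s1 : Summable fun n : ℕ => cP n * Real.exp (-(δ * Real.log n)))
    (s2 : Summable fun n : ℕ => 1 / (n:ℝ) * Real.exp (-(δ * n))) :
    (∑' n : ℕ, cP n * Real.exp (-(δ * Real.log n))) - ∑' n : ℕ, 1 / (n:ℝ) * Real.exp (-(δ * n))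
      = ∫ u in Set.Ioi (0:ℝ), Real.exp (-u) * BB (u / δ) := by
  have i1 := fun n : ℕ => int_thresh (δ * Real.log n)
    (mul_nonneg hδ.le (Real.log_natCast_nonneg n)) (cP n)
  have i2 := fun n : ℕ => int_thresh (δ * n) (by positivity) (1 / (n:ℝ))
  have hs := MeasureTheory.hasSum_integral_of_summable_integral_norm
    (μ := MeasureTheory.volume.restrict (Set.Ioi (0:ℝ)))
    (F := fun (n : ℕ) (u : ℝ) => Real.exp (-u) * (if δ * Real.log n ≤ u then cP n else 0)
      - Real.exp (-u) * (if δ * n ≤ u then 1 / (n:ℝ) else 0))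
    (fun n => (i1 n).1.sub (i2 n).1) ?_
  · have e1 : ∀ n : ℕ, ∫ u in Set.Ioi (0:ℝ), (Real.exp (-u) * (if δ * Real.log n ≤ u then cP n else 0)
      - Real.exp (-u) * (if δ * n ≤ u then 1 / (n:ℝ) else 0)) =
      cP n * Real.exp (-(δ * Real.log n)) - 1 / (n:ℝ) * Real.exp (-(δ * n)) := by
      intro n
      rw [MeasureTheory.integral_sub (i1 n).1 (i2 n).1, (i1 n).2, (i2 n).2]
    simp only [e1] at hs
    rw [← s1.tsum_sub s2, hs.tsum_eq]
    refine MeasureTheory.setIntegral_congr_fun measurableSet_Ioi fun u hu => ?_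
    have hu : 0 < u := hu
    simp only [← mul_sub]
    rw [tsum_mul_left]
    congr 1
    have hud : 0 < u / δ := by positivity
    have t1 : HasSum (fun n : ℕ => if δ * Real.log n ≤ u then cP n else 0)
        (∑ i ∈ Finset.range (⌊Real.exp (u/δ)⌋₊+1), cP i) := by
      have : ∑ i ∈ Finset.range (⌊Real.exp (u/δ)⌋₊+1), cP i =
          ∑ i ∈ Finset.range (⌊Real.exp (u/δ)⌋₊+1), (if δ * Real.log i ≤ u then cP i else 0) := by
        refine Finset.sum_congr rfl fun i hi => ?_
        rcases Nat.eq_zero_or_pos i with rfl | hi0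
        · simp [cP, Nat.not_prime_zero]
        rw [if_pos]
        have hi' : i ≤ ⌊Real.exp (u/δ)⌋₊ := by simpa [Nat.lt_succ_iff] using hi
        rw [Nat.le_floor_iff (Real.exp_pos _).le] at hi'
        rw [mul_comm, ← le_div_iff₀ hδ, Real.log_le_iff_le_exp (by exact_mod_cast hi0)]
        exact hi'
      rw [this]
      refine hasSum_sum_of_ne_finset_zero fun i hi => ?_
      rw [if_neg]
      have hi' : ¬ i ≤ ⌊Real.exp (u/δ)⌋₊ := by simpa [Nat.lt_succ_iff] using hi
      rw [Nat.le_floor_iff (Real.exp_pos _).le] at hi'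
      have hi0 : (0:ℝ) < i := (Real.exp_pos _).trans (not_le.1 hi')
      rw [mul_comm, ← le_div_iff₀ hδ, Real.log_le_iff_le_exp hi0]
      exact hi'
    have t2 : HasSum (fun n : ℕ => if δ * n ≤ u then 1 / (n:ℝ) else 0)
        (∑ i ∈ Finset.range (⌊u/δ⌋₊+1), 1 / (i:ℝ)) := by
      have : ∑ i ∈ Finset.range (⌊u/δ⌋₊+1), 1 / (i:ℝ) =
          ∑ i ∈ Finset.range (⌊u/δ⌋₊+1), (if δ * i ≤ u then 1 / (i:ℝ) else 0) := by
        refine Finset.sum_congr rfl fun i hi => ?_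
        rw [if_pos]
        have hi' : i ≤ ⌊u/δ⌋₊ := by simpa [Nat.lt_succ_iff] using hi
        rw [Nat.le_floor_iff hud.le] at hi'
        rw [mul_comm, ← le_div_iff₀ hδ]
        exact hi'
      rw [this]
      refine hasSum_sum_of_ne_finset_zero fun i hi => ?_
      rw [if_neg]
      have hi' : ¬ i ≤ ⌊u/δ⌋₊ := by simpa [Nat.lt_succ_iff] using hi
      rw [Nat.le_floor_iff hud.le] at hi'
      rw [mul_comm, ← le_div_iff₀ hδ]
      exact hi'
    rw [(t1.sub t2).tsum_eq, BB]
  · refine Summable.of_nonneg_of_le (fun n => MeasureTheory.integral_nonneg fun u => norm_nonneg _)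
      (fun n => ?_) (s1.add s2)
    rw [← (i1 n).2, ← (i2 n).2, ← MeasureTheory.integral_add (i1 n).1 (i2 n).1]
    refine MeasureTheory.integral_mono ((i1 n).1.sub (i2 n).1).norm ((i1 n).1.add (i2 n).1) fun u => ?_
    have a1 : 0 ≤ Real.exp (-u) * (if δ * Real.log n ≤ u then cP n else 0) := by
      refine mul_nonneg (Real.exp_pos _).le ?_
      split_ifs
      · exact cP_nonneg n
      · exact le_rfl
    have a2 : 0 ≤ Real.exp (-u) * (if δ * n ≤ u then 1 / (n:ℝ) else 0) := by
      refine mul_nonneg (Real.exp_pos _).le ?_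
      split_ifs
      · positivity
      · exact le_rfl
    simp only [Real.norm_eq_abs]
    rw [abs_le]; constructor <;> linarith

lemma exp_sum (δ : ℝ) (hδ : 0 < δ) :
    HasSum (fun n : ℕ => 1 / (n:ℝ) * Real.exp (-(δ * n))) (-Real.log (1 - Real.exp (-δ))) := by
  have h := Real.hasSum_pow_div_log_of_abs_lt_one (x := Real.exp (-δ)) (by
    rw [abs_of_pos (Real.exp_pos _), Real.exp_lt_one_iff]; linarith)
  rw [← hasSum_nat_add_iff' 1]
  simp only [Finset.range_one, Finset.sum_singleton, Nat.cast_zero, div_zero, zero_mul, sub_zero]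
  have e : (fun n : ℕ => 1 / ((n + 1 : ℕ):ℝ) * Real.exp (-(δ * ((n + 1 : ℕ):ℝ)))) =
      fun n : ℕ => Real.exp (-δ) ^ (n + 1) / ((n:ℝ) + 1) := by
    ext n
    rw [← Real.exp_nat_mul]
    push_cast
    ring_nf
  rw [e]
  exact h

lemma log_bound {x : ℝ} (_ : 0 ≤ x) (h1 : x ≤ 1/2) :
    0 ≤ -Real.log (1 - x) - x ∧ -Real.log (1 - x) - x ≤ 2 * x ^ 2 := by
  constructor
  · have := Real.log_le_sub_one_of_pos (show 0 < 1 - x by linarith)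
    linarith
  · have h := Real.one_sub_inv_le_log_of_pos (show 0 < 1 - x by linarith)
    have h2 : (1 - x)⁻¹ - 1 - x = x ^ 2 / (1 - x) := by
      have : 1 - x ≠ 0 := by linarith
      field_simp; ring
    have h3 : x ^ 2 / (1 - x) ≤ 2 * x ^ 2 := by
      rw [div_le_iff₀ (by linarith)]
      nlinarith [sq_nonneg x]
    linarith

/-- remainder term at exponent `1 + δ` -/
noncomputable def rP (δ : ℝ) (n : ℕ) : ℝ :=
  if n.Prime then -Real.log (1 - (n:ℝ) ^ (-(1+δ))) - (n:ℝ) ^ (-(1+δ)) else 0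

lemma rpow_bd {n : ℕ} (hn : n.Prime) {δ : ℝ} (hδ : 0 ≤ δ) :
    0 ≤ (n:ℝ) ^ (-(1+δ)) ∧ (n:ℝ) ^ (-(1+δ)) ≤ 1 / n ∧ (1 / n : ℝ) ≤ 1/2 := by
  have h2 : (2:ℝ) ≤ n := by exact_mod_cast hn.two_le
  refine ⟨by positivity, ?_, ?_⟩
  · rw [one_div, ← Real.rpow_neg_one]
    exact Real.rpow_le_rpow_of_exponent_le (by linarith) (by linarith)
  · exact one_div_le_one_div_of_le (by norm_num) h2

lemma rP_bd {δ : ℝ} (hδ : 0 ≤ δ) (n : ℕ) : ‖rP δ n‖ ≤ 2 * (1 / (n:ℝ) ^ 2) := by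
  unfold rP
  split_ifs with hn
  · obtain ⟨h0, h1, h2⟩ := rpow_bd hn hδ
    obtain ⟨a, b⟩ := log_bound h0 (h1.trans h2)
    rw [Real.norm_eq_abs, abs_of_nonneg a]
    refine b.trans ?_
    have : ((n:ℝ) ^ (-(1+δ)))^2 ≤ (1 / n)^2 := by gcongr
    rw [div_pow, one_pow] at this
    linarith
  · simp

lemma bd_summable : Summable (fun n : ℕ => 2 * (1 / (n:ℝ) ^ 2)) :=
  (Real.summable_one_div_nat_pow.2 (by norm_num)).mul_left 2

lemma rP_summable {δ : ℝ} (hδ : 0 ≤ δ) : Summable (rP δ) :=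
  Summable.of_norm_bounded bd_summable (rP_bd hδ)

lemma rP_tendsto : Tendsto (fun δ : ℝ => ∑' n, rP δ n) (𝓝[>] 0) (𝓝 (∑' n, rP 0 n)) := by
  refine tendsto_tsum_of_dominated_convergence bd_summable (fun n => ?_) ?_
  · unfold rP
    split_ifs with hn
    · have h2 : (2:ℝ) ≤ n := by exact_mod_cast hn.two_le
      have hc : ContinuousAt (fun δ : ℝ => (n:ℝ) ^ (-(1+δ))) 0 := by
        apply ContinuousAt.rpow continuousAt_const (by fun_prop)
        left; linarith
      obtain ⟨h0, h1, h2⟩ := rpow_bd hn (le_refl (0:ℝ))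
      have hne : 1 - (n:ℝ) ^ (-(1+(0:ℝ))) ≠ 0 :=
        (sub_pos.2 (lt_of_le_of_lt (h1.trans h2) (by norm_num))).ne'
      have hc2 : ContinuousAt (fun δ : ℝ => -Real.log (1 - (n:ℝ) ^ (-(1+δ))) - (n:ℝ) ^ (-(1+δ))) 0 :=
        ((ContinuousAt.log (continuousAt_const.sub hc)
          hne).neg).sub hc
      exact hc2.tendsto.mono_left nhdsWithin_le_nhds
    · exact tendsto_const_nhds
  · filter_upwards [self_mem_nhdsWithin] with δ hδ n
    exact rP_bd (le_of_lt hδ) n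

lemma cP_exp (δ : ℝ) (n : ℕ) : cP n * Real.exp (-(δ * Real.log n)) =
    if n.Prime then (n:ℝ) ^ (-(1+δ)) else 0 := by
  unfold cP
  split_ifs with hn
  · have h0 : (0:ℝ) < n := by exact_mod_cast hn.pos
    rw [show -(1+δ) = -1 + -δ by ring, Real.rpow_add h0, Real.rpow_neg_one,
      Real.rpow_def_of_pos h0 (-δ), one_div]
    congr 2; ring
  · simp

lemma s1_summable {δ : ℝ} (hδ : 0 < δ) :
    Summable fun n : ℕ => cP n * Real.exp (-(δ * Real.log n)) := by
  simp only [cP_exp]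
  refine Summable.of_nonneg_of_le (fun n => ?_) (fun n => ?_)
    (Real.summable_nat_rpow.2 (show -(1+δ) < -1 by linarith))
  · split_ifs <;> positivity
  · split_ifs
    · exact le_rfl
    · positivity

lemma zeta_log {δ : ℝ} (hδ : 0 < δ) :
    Real.log (riemannZeta ((1 + δ : ℝ) : ℂ)).re =
      ∑' n : ℕ, cP n * Real.exp (-(δ * Real.log n)) + ∑' n, rP δ n := by
  rw [← (s1_summable hδ).tsum_add (rP_summable hδ.le)]
  have h := riemannZeta_eulerProduct_exp_log (s := ((1 + δ : ℝ) : ℂ)) (by simp; exact hδ)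
  have e1 : ∑' p : Nat.Primes, -Complex.log (1 - (p:ℂ) ^ (-((1 + δ : ℝ) : ℂ))) =
      ((∑' p : Nat.Primes, -Real.log (1 - ((p:ℕ):ℝ) ^ (-(1+δ))) : ℝ) : ℂ) := by
    rw [Complex.ofReal_tsum]
    refine tsum_congr fun p => ?_
    obtain ⟨h0, h1, h2⟩ := rpow_bd p.2 hδ.le
    rw [Complex.ofReal_neg, Complex.ofReal_log (by linarith)]
    push_cast
    rw [Complex.ofReal_cpow (by positivity)]
    push_cast
    rfl
  rw [e1, ← Complex.ofReal_exp] at h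
  rw [← h, Complex.ofReal_re, Real.log_exp,
    Nat.Primes.tsum_eq_tsum_ite (fun n : ℕ => -Real.log (1 - (n:ℝ) ^ (-(1+δ))))]
  refine tsum_congr fun n => ?_
  rw [cP_exp, rP]
  split_ifs <;> ring

lemma zeta_lim : Tendsto (fun δ : ℝ => Real.log (riemannZeta ((1 + δ : ℝ) : ℂ)).re
    + Real.log (1 - Real.exp (-δ))) (𝓝[>] 0) (𝓝 0) := by
  have h1 := (Asymptotics.isLittleO_one_iff ℝ).1 log_riemannZeta_add_log_sub_isLittleO_ofReal
  have hm : Tendsto (fun δ : ℝ => 1 + δ) (𝓝[>] 0) (𝓝[>] 1) := by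
    refine tendsto_nhdsWithin_iff.2 ⟨?_, ?_⟩
    · have : Tendsto (fun δ : ℝ => 1 + δ) (𝓝 0) (𝓝 (1 + 0)) := by
        exact (continuous_const.add continuous_id).tendsto 0
      rw [add_zero] at this
      exact this.mono_left nhdsWithin_le_nhds
    · filter_upwards [self_mem_nhdsWithin] with δ hδ
      have : 0 < δ := hδ
      simp [this]
  have h2 := h1.comp hm
  have h3 : Tendsto (fun δ : ℝ => (1 - Real.exp (-δ)) / δ) (𝓝[>] 0) (𝓝 1) := by
    have hd : HasDerivAt (fun δ : ℝ => 1 - Real.exp (-δ)) 1 0 := by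
      have := ((hasDerivAt_neg (0:ℝ)).exp).const_sub 1
      simpa using this
    have := hd.hasDerivWithinAt (s := Set.Ioi 0)
    rw [hasDerivWithinAt_iff_tendsto_slope' (by simp)] at this
    refine this.congr fun δ => ?_
    simp [slope_def_field]
  have h4 := h3.log one_ne_zero
  rw [Real.log_one] at h4
  have h5 := h2.add h4
  rw [add_zero] at h5
  refine h5.congr' ?_
  filter_upwards [self_mem_nhdsWithin] with δ hδ
  have hδ : 0 < δ := hδ
  have : 0 < 1 - Real.exp (-δ) := by
    have : Real.exp (-δ) < 1 := by rw [Real.exp_lt_one_iff]; linarith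
    linarith
  simp only [Function.comp]
  rw [Real.log_div this.ne' hδ.ne', add_sub_cancel_left]
  ring

lemma mertens_const {C : ℝ} (hC : Tendsto (fun n : ℕ => ∑ i ∈ Finset.range (n+1), cP i
    - Real.log (Real.log n)) atTop (𝓝 C)) :
    C = Real.eulerMascheroniConstant - ∑' n, rP 0 n := by
  have h1 := abel_lim (BB_tendsto hC)
  have h2 := zeta_lim.sub rP_tendsto
  have h3 := tendsto_nhds_unique h1 (h2.congr' ?_)
  · linarith
  · filter_upwards [self_mem_nhdsWithin] with δ hδ
    have hδ : 0 < δ := hδ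
    rw [← tonelli δ hδ (s1_summable hδ) (exp_sum δ hδ).summable, (exp_sum δ hδ).tsum_eq,
      zeta_log hδ]
    ring

lemma mertens_three : Tendsto (fun n : ℕ => Real.log n *
    ∏ p ∈ (Finset.range (n+1)).filter Nat.Prime, (1 - 1 / (p:ℝ))) atTop
    (𝓝 (Real.exp (-Real.eulerMascheroniConstant))) := by
  obtain ⟨C, hC⟩ := mertens_two
  have hCe := mertens_const hC
  have hr := ((rP_summable (le_refl (0:ℝ))).hasSum.tendsto_sum_nat).comp (tendsto_add_atTop_nat 1)
  have h := (hC.add hr).neg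
  rw [hCe, sub_add_cancel] at h
  refine ((Real.continuous_exp.tendsto _).comp h).congr' ?_
  filter_upwards [eventually_ge_atTop 2] with n hn
  have hn2 : (2:ℝ) ≤ n := by exact_mod_cast hn
  have hl : 0 < Real.log n := Real.log_pos (by linarith)
  simp only [Function.comp]
  have hp : ∏ p ∈ (Finset.range (n+1)).filter Nat.Prime, (1 - 1 / (p:ℝ)) =
      Real.exp (∑ p ∈ (Finset.range (n+1)).filter Nat.Prime, Real.log (1 - 1 / (p:ℝ))) := by
    rw [Real.exp_sum]
    refine Finset.prod_congr rfl fun p hp => ?_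
    obtain ⟨h0, h1, h2⟩ := rpow_bd (Finset.mem_filter.1 hp).2 (le_refl (0:ℝ))
    rw [Real.exp_log (by linarith)]
  rw [hp]
  nth_rw 2 [← Real.exp_log hl]
  rw [← Real.exp_add]
  congr 1
  have : ∑ i ∈ Finset.range (n+1), cP i + ∑ i ∈ Finset.range (n+1), rP 0 i =
      - ∑ p ∈ (Finset.range (n+1)).filter Nat.Prime, Real.log (1 - 1 / (p:ℝ)) := by
    rw [← Finset.sum_add_distrib, ← Finset.sum_neg_distrib, Finset.sum_filter]
    refine Finset.sum_congr rfl fun i _ => ?_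
    unfold cP rP
    split_ifs
    · rw [add_zero, Real.rpow_neg_one, one_div]; ring
    · simp
  linarith

lemma ceil_tendsto : Tendsto (fun z : ℝ => ⌈z⌉₊ - 1) atTop atTop :=
  (tendsto_sub_atTop_nat 1).comp tendsto_nat_ceil_atTop

lemma log_ceil_sub : Tendsto (fun z : ℝ => Real.log z - Real.log ((⌈z⌉₊ - 1 : ℕ) : ℝ))
    atTop (𝓝 0) := by
  have h1 := (tendsto_nat_ceil_div_atTop (R := ℝ)).sub (tendsto_inv_atTop_zero (𝕜 := ℝ))
  rw [sub_zero] at h1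
  have h := (h1.log one_ne_zero).neg
  rw [Real.log_one, neg_zero] at h
  refine h.congr' ?_
  filter_upwards [eventually_gt_atTop 1] with x hx
  have hc : 1 < ⌈x⌉₊ := by rw [Nat.lt_ceil]; simpa using hx
  have hc' : (1:ℝ) < ⌈x⌉₊ := by exact_mod_cast hc
  rw [Nat.cast_sub hc.le, Nat.cast_one, inv_eq_one_div, ← sub_div,
    Real.log_div (by linarith) (by linarith)]
  ring

lemma mertens_real : Tendsto (fun z : ℝ => Real.log z *
    ∏ p ∈ (Finset.range ⌈z⌉₊).filter Nat.Prime, (1 - 1 / (p:ℝ))) atTop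
    (𝓝 (Real.exp (-Real.eulerMascheroniConstant))) := by
  have h1 := mertens_three.comp ceil_tendsto
  have h2 : Tendsto (fun z : ℝ => (Real.log z - Real.log ((⌈z⌉₊ - 1 : ℕ) : ℝ)) *
      ∏ p ∈ (Finset.range ⌈z⌉₊).filter Nat.Prime, (1 - 1 / (p:ℝ))) atTop (𝓝 0) := by
    refine squeeze_zero_norm (fun z => ?_) (tendsto_zero_iff_norm_tendsto_zero.1 log_ceil_sub)
    rw [norm_mul]
    refine mul_le_of_le_one_right (norm_nonneg _) ?_
    rw [norm_prod]
    refine Finset.prod_le_one (fun _ _ => norm_nonneg _) fun p hp => ?_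
    obtain ⟨h0, h1, h2⟩ := rpow_bd (Finset.mem_filter.1 hp).2 (le_refl (0:ℝ))
    have h4 := h0.trans h1
    clear h0 h1
    rw [Real.norm_eq_abs, abs_le]
    constructor <;> linarith
  have h3 := h1.add h2
  rw [add_zero] at h3
  refine h3.congr' ?_
  filter_upwards [eventually_gt_atTop 0] with z hz
  have hc : 0 < ⌈z⌉₊ := Nat.ceil_pos.2 hz
  simp only [Function.comp]
  rw [Nat.sub_add_cancel hc]
  ring

lemma odd_lim : Tendsto (fun n : ℕ => ∏ q ∈ (Finset.range n).filter (fun p => p.Prime ∧ 2 < p),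
    (1 - 1 / ((q:ℝ) - 1) ^ 2)) atTop (𝓝 prodOddPrimes) := by
  set g : ℕ → ℝ := fun n => if n.Prime ∧ 2 < n then - (1 / ((n:ℝ) - 1) ^ 2) else 0 with hg
  have hs : Summable g := by
    refine Summable.of_norm_bounded (g := fun n : ℕ => 4 * (1 / (n:ℝ) ^ 2))
      ((Real.summable_one_div_nat_pow.2 (by norm_num)).mul_left 4) fun n => ?_
    simp only [hg]
    split_ifs with h
    · have h2 : (2:ℝ) < n := by exact_mod_cast h.2
      rw [norm_neg, Real.norm_eq_abs, abs_of_nonneg (by positivity), ← div_eq_mul_one_div,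
        div_le_div_iff₀ (by nlinarith) (by nlinarith)]
      nlinarith
    · simp
  have hm := Real.multipliable_one_add_of_summable hs
  have e : ∏' n, (1 + g n) = prodOddPrimes := by
    have := tprod_subtype {p : ℕ | p.Prime ∧ 2 < p} (fun p : ℕ => 1 - 1 / ((p:ℝ) - 1) ^ 2)
    unfold prodOddPrimes
    refine Eq.trans ?_ this.symm
    refine tprod_congr fun n => ?_
    simp only [hg, Set.mulIndicator_apply, Set.mem_ofPred_eq]
    split_ifs <;> ring
  rw [← e]
  refine hm.hasProd.tendsto_prod_nat.congr fun n => ?_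
  rw [Finset.prod_filter]
  refine Finset.prod_congr rfl fun i _ => ?_
  simp only [hg]
  split_ifs <;> ring

lemma V_eq (b : ℕ) (hb : 0 < b) (z : ℝ) (hz : (b:ℝ) + 3 < z) :
    V b z = 2 * prodOddPrimesDvd b *
      (∏ p ∈ (Finset.range ⌈z⌉₊).filter Nat.Prime, (1 - 1 / (p:ℝ))) *
      ∏ q ∈ (Finset.range ⌈z⌉₊).filter (fun p => p.Prime ∧ 2 < p), (1 - 1 / ((q:ℝ) - 1) ^ 2) := by
  classical
  set S := (Finset.range ⌈z⌉₊).filter (fun p => p.Prime ∧ 2 < p) with hS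
  have hV : V b z = ∏ q ∈ S.filter (fun q => ¬ q ∣ b), (1 - 1 / ((q:ℝ) - 1)) := by
    unfold V
    refine Finset.prod_congr ?_ fun _ _ => rfl
    ext q
    simp only [hS, Finset.mem_filter, Finset.mem_range, ← Nat.lt_ceil]
    constructor
    · rintro ⟨_, hp, hlt, hd⟩
      refine ⟨⟨hlt, hp, lt_of_le_of_ne hp.two_le ?_⟩, fun h => hd (h.mul_left 2)⟩
      rintro rfl
      exact hd (dvd_mul_right 2 b)
    · rintro ⟨⟨hlt, hp, h2⟩, hd⟩
      refine ⟨by omega, hp, hlt, fun h => ?_⟩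
      rcases hp.dvd_mul.1 h with h | h
      · have := Nat.le_of_dvd (by norm_num) h
        omega
      · exact hd h
  have hD : S.filter (fun q => q ∣ b) = b.primeFactors.filter (fun p => 2 < p) := by
    ext q
    simp only [hS, Finset.mem_filter, Finset.mem_range, Nat.mem_primeFactors]
    constructor
    · rintro ⟨⟨_, hp, h2⟩, hd⟩
      exact ⟨⟨hp, hd, hb.ne'⟩, h2⟩
    · rintro ⟨⟨hp, hd, _⟩, h2⟩
      refine ⟨⟨?_, hp, h2⟩, hd⟩
      rw [Nat.lt_ceil]
      have : (q:ℝ) ≤ b := by exact_mod_cast Nat.le_of_dvd hb hd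
      linarith
  have hsplit := Finset.prod_filter_mul_prod_filter_not S (fun q => q ∣ b)
    (fun q : ℕ => 1 - 1 / ((q:ℝ) - 1))
  rw [hD, ← hV] at hsplit
  have hinv : prodOddPrimesDvd b *
      ∏ q ∈ b.primeFactors.filter (fun p => 2 < p), (1 - 1 / ((q:ℝ) - 1)) = 1 := by
    unfold prodOddPrimesDvd
    rw [← Finset.prod_mul_distrib]
    refine Finset.prod_eq_one fun q hq => ?_
    have h2 : (2:ℝ) < q := by exact_mod_cast (Finset.mem_filter.1 hq).2
    have a1 : (q:ℝ) - 1 ≠ 0 := by linarith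
    have a2 : (q:ℝ) - 2 ≠ 0 := by linarith
    field_simp
    ring
  have h2 : (Finset.range ⌈z⌉₊).filter Nat.Prime = insert 2 S := by
    ext q
    simp only [hS, Finset.mem_filter, Finset.mem_range, Finset.mem_insert]
    constructor
    · rintro ⟨h, hp⟩
      rcases hp.two_le.eq_or_lt with h' | h'
      · exact Or.inl h'.symm
      · exact Or.inr ⟨h, hp, h'⟩
    · rintro (rfl | h)
      · refine ⟨?_, Nat.prime_two⟩
        rw [Nat.lt_ceil]
        have : (0:ℝ) ≤ b := b.cast_nonneg
        push_cast; linarith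
      · exact ⟨h.1, h.2.1⟩
  have hprod : ∏ q ∈ S, (1 - 1 / ((q:ℝ) - 1)) =
      (∏ q ∈ S, (1 - 1 / (q:ℝ))) * ∏ q ∈ S, (1 - 1 / ((q:ℝ) - 1) ^ 2) := by
    rw [← Finset.prod_mul_distrib]
    refine Finset.prod_congr rfl fun q hq => ?_
    have h2 : (2:ℝ) < q := by exact_mod_cast (Finset.mem_filter.1 hq).2.2
    have a1 : (q:ℝ) - 1 ≠ 0 := by linarith
    have a2 : (q:ℝ) ≠ 0 := by linarith
    field_simp
    ring
  rw [h2, Finset.prod_insert (by simp [hS])]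
  calc V b z = prodOddPrimesDvd b * ((∏ q ∈ b.primeFactors.filter (fun p => 2 < p),
        (1 - 1 / ((q:ℝ) - 1))) * V b z) := by rw [← mul_assoc, hinv, one_mul]
    _ = _ := by rw [hsplit, hprod]; push_cast; ring

theorem stmt14 (b : ℕ) (hb : 0 < b) (hbodd : Odd b) :
    Filter.Tendsto (fun z : ℝ => Real.log z * V b z) Filter.atTop
      (nhds (2 * Real.exp (-Real.eulerMascheroniConstant) *
        prodOddPrimesDvd b * prodOddPrimes)) := by
  have h1 := ((mertens_real.const_mul 2).mul_const (prodOddPrimesDvd b)).mul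
    (odd_lim.comp tendsto_nat_ceil_atTop)
  refine h1.congr' ?_
  filter_upwards [eventually_gt_atTop ((b:ℝ) + 3)] with z hz
  rw [V_eq b hb z hz]
  simp only [Function.comp]
  ring
end

section
/- Let 0 < δ < 1/3 be a fixed constant and set C_δ = ∫_δ^{1/3} log(2 − 3β)/(β(1 − β)) dβ. Then there exist constants C > 0 and x₀ ≥ 3 such that for all real x ≥ x₀, | ∑_{x^δ ≤ p₁ < x^{1/3}} (1/p₁) · ∑_{x^{1/3} ≤ p₂ < (x/p₁)^{1/2}} 1/(p₂ · log(x/(p₁p₂))) − C_δ / log x | ≤ C / (log x)², where p₁ and p₂ run over primes in the indicated ranges. -/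
open scoped Classical in
/-- The double sum `∑_{x^δ ≤ p₁ < x^{1/3}} (1/p₁) ∑_{x^{1/3} ≤ p₂ < (x/p₁)^{1/2}}
1/(p₂ log(x/(p₁p₂)))`, where `p₁, p₂` run over primes. -/
noncomputable def doubleSum (δ x : ℝ) : ℝ :=
  ∑ p₁ ∈ (Finset.range (⌊x⌋₊ + 1)).filter
      (fun p : ℕ => p.Prime ∧ x ^ δ ≤ (p : ℝ) ∧ (p : ℝ) < x ^ ((1 : ℝ) / 3)),
    (1 / (p₁ : ℝ)) *
      ∑ p₂ ∈ (Finset.range (⌊x⌋₊ + 1)).filter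
          (fun p : ℕ => p.Prime ∧ x ^ ((1 : ℝ) / 3) ≤ (p : ℝ) ∧
            (p : ℝ) < (x / (p₁ : ℝ)) ^ ((1 : ℝ) / 2)),
        1 / ((p₂ : ℝ) * Real.log (x / ((p₁ : ℝ) * (p₂ : ℝ))))

/-- Elementary bound for the sum of `log n / (n (n-1))`. -/
lemma aux_sum_log (N : ℕ) (hN : 1 ≤ N) :
    ∑ n ∈ Finset.Icc 2 N, Real.log n / ((n : ℝ) * ((n : ℝ) - 1)) ≤ 2 - (Real.log N + 2) / N := by
  induction N, hN using Nat.le_induction with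
  | base => simp
  | succ m hm ih =>
    rw [Finset.sum_Icc_succ_top (by omega)]
    have hm0 : (0 : ℝ) < m := by exact_mod_cast hm
    have hm1 : (1 : ℝ) ≤ m := by exact_mod_cast hm
    have h1 : Real.log ((m : ℝ) + 1) - Real.log m ≤ 1 / m := by
      rw [← Real.log_div (by positivity) (by positivity)]
      have := Real.log_le_sub_one_of_pos (x := ((m : ℝ) + 1) / m) (by positivity)
      have h2 : ((m : ℝ) + 1) / m - 1 = 1 / m := by field_simp; ring
      linarith
    push_cast
    have h3 : Real.log ((m : ℝ) + 1) / (((m : ℝ) + 1) * ((m : ℝ) + 1 - 1)) ≤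
        (Real.log m + 2) / m - (Real.log ((m : ℝ) + 1) + 2) / ((m : ℝ) + 1) := by
      have e : (Real.log m + 2) / m - (Real.log ((m : ℝ) + 1) + 2) / ((m : ℝ) + 1) -
          Real.log ((m : ℝ) + 1) / (((m : ℝ) + 1) * ((m : ℝ) + 1 - 1)) =
          (2 - (m + 1) * (Real.log ((m : ℝ) + 1) - Real.log m)) / (m * (m + 1)) := by
        rw [add_sub_cancel_right]
        field_simp
        ring
      have h4 : (m + 1) * (Real.log ((m : ℝ) + 1) - Real.log m) ≤ 2 := by
        calc (m + 1) * (Real.log ((m : ℝ) + 1) - Real.log m) ≤ (m + 1) * (1 / m) := by gcongr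
          _ ≤ 2 := by
            rw [mul_one_div, div_le_iff₀ hm0]; linarith
      have : 0 ≤ (2 - (m + 1) * (Real.log ((m : ℝ) + 1) - Real.log m)) / (m * (m + 1)) :=
        div_nonneg (by linarith) (by positivity)
      linarith
    linarith

lemma log_factorial_primes (N : ℕ) :
    Real.log (N.factorial) = ∑ p ∈ Nat.primesLE N, (N.factorial.factorization p : ℝ) * Real.log p := by
  rw [Real.log_nat_eq_sum_factorization, Finsupp.sum]
  apply Finset.sum_subset
  · intro p hp
    have hp' : p ∈ N.factorial.primeFactors := by simpa using hp
    rw [Nat.mem_primeFactors] at hp'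
    rw [Nat.mem_primesLE]
    exact ⟨(hp'.1.dvd_factorial).1 hp'.2.1, hp'.1⟩
  · intro p _ hp
    simp only [Finsupp.mem_support_iff, not_not] at hp
    simp [hp]

lemma mertens_nat (N : ℕ) (hN : 1 ≤ N) :
    |∑ p ∈ Nat.primesLE N, Real.log p / p - Real.log N| ≤ 3 := by
  have hN0 : (0 : ℝ) < N := by exact_mod_cast hN
  have hl4 : Real.log 4 ≤ 2 := by
    have : Real.log 4 = 2 * Real.log 2 := by
      rw [show (4 : ℝ) = 2 ^ 2 by norm_num, Real.log_pow]; norm_num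
    linarith [Real.log_two_lt_d9]
  rw [abs_le]
  constructor
  · have h1 := Stirling.le_log_factorial_stirling (n := N) (by omega)
    have h2 : Real.log N ≥ 0 := Real.log_natCast_nonneg N
    have h3 : 0 ≤ Real.log (2 * Real.pi) := Real.log_nonneg (by linarith [Real.pi_gt_three])
    have h4 : Real.log (N.factorial) ≤ ∑ p ∈ Nat.primesLE N,
        (N * (Real.log p / p) + N * (Real.log p / ((p : ℝ) * ((p : ℝ) - 1)))) := by
      rw [log_factorial_primes]
      apply Finset.sum_le_sum
      intro p hp
      have hpp := (Nat.mem_primesLE.1 hp).2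
      have hp2 : (2 : ℝ) ≤ p := by exact_mod_cast hpp.two_le
      have h5 := Nat.sub_one_mul_factorization_factorial (n := N) hpp
      have h6 : ((p : ℝ) - 1) * (N.factorial.factorization p) ≤ N := by
        have : (p - 1) * (N.factorial.factorization p) ≤ N := by omega
        have h7 : (((p - 1) * (N.factorial.factorization p) : ℕ) : ℝ) ≤ N := by exact_mod_cast this
        rw [Nat.cast_mul, Nat.cast_sub hpp.one_le] at h7
        simpa using h7
      have h8 : (N.factorial.factorization p : ℝ) ≤ N / ((p : ℝ) - 1) := by
        rw [le_div_iff₀ (by linarith)]; linarith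
      have h9 : 0 ≤ Real.log p := Real.log_natCast_nonneg p
      calc (N.factorial.factorization p : ℝ) * Real.log p ≤ N / ((p : ℝ) - 1) * Real.log p := by
            gcongr
        _ = _ := by
          have : (p : ℝ) - 1 ≠ 0 := by linarith
          field_simp
          ring
    rw [Finset.sum_add_distrib, ← Finset.mul_sum, ← Finset.mul_sum] at h4
    have h5 : ∑ p ∈ Nat.primesLE N, Real.log p / ((p : ℝ) * ((p : ℝ) - 1)) ≤ 2 := by
      calc _ ≤ ∑ n ∈ Finset.Icc 2 N, Real.log n / ((n : ℝ) * ((n : ℝ) - 1)) := by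
            apply Finset.sum_le_sum_of_subset_of_nonneg
            · intro p hp
              have := Nat.mem_primesLE.1 hp
              exact Finset.mem_Icc.2 ⟨this.2.two_le, this.1⟩
            · intro n hn _
              have h2n : (2 : ℝ) ≤ n := by exact_mod_cast (Finset.mem_Icc.1 hn).1
              exact div_nonneg (Real.log_natCast_nonneg n)
                (mul_nonneg (by linarith) (by linarith))
        _ ≤ 2 - (Real.log N + 2) / N := aux_sum_log N hN
        _ ≤ 2 := by
          have : 0 ≤ (Real.log N + 2) / N := by positivity
          linarith
    have h6 : N * (Real.log N - 1) ≤
        N * (∑ p ∈ Nat.primesLE N, Real.log p / p + 2) := by nlinarith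
    have := le_of_mul_le_mul_left h6 hN0
    linarith
  · have h1 : Real.log (N.factorial) ≤ N * Real.log N := by
      rw [← Real.log_pow]
      apply Real.log_le_log (by exact_mod_cast N.factorial_pos)
      exact_mod_cast Nat.factorial_le_pow N
    have h2 : ∑ p ∈ Nat.primesLE N, (N * (Real.log p / p) - Real.log p) ≤
        Real.log (N.factorial) := by
      rw [log_factorial_primes]
      apply Finset.sum_le_sum
      intro p hp
      have hpp := (Nat.mem_primesLE.1 hp).2
      have hp0 : (0 : ℝ) < p := by exact_mod_cast hpp.pos
      have h3 : N / p ≤ N.factorial.factorization p := by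
        rw [Nat.factorization_factorial hpp (b := Nat.log p N + 2) (by omega)]
        calc N / p = N / p ^ 1 := by simp
          _ ≤ _ := Finset.single_le_sum (f := fun i => N / p ^ i) (fun _ _ => Nat.zero_le _)
              (by simp)
      have h4 : (N : ℝ) / p - 1 ≤ N.factorial.factorization p := by
        have h5 : (N : ℝ) / p < (N / p : ℕ) + 1 := by
          rw [← Nat.floor_div_eq_div (K := ℝ)]; exact Nat.lt_floor_add_one _
        have h6 : ((N / p : ℕ) : ℝ) ≤ N.factorial.factorization p := by exact_mod_cast h3
        linarith
      have h9 : 0 ≤ Real.log p := Real.log_natCast_nonneg p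
      calc N * (Real.log p / p) - Real.log p = ((N : ℝ) / p - 1) * Real.log p := by ring
        _ ≤ _ := by gcongr
    rw [Finset.sum_sub_distrib, ← Finset.mul_sum, ← Chebyshev.theta_eq_sum_primesLE_log] at h2
    have h3 := Chebyshev.theta_le_log4_mul_x (x := N) hN0.le
    have h6 : N * (∑ p ∈ Nat.primesLE N, Real.log p / p) ≤ N * (Real.log N + 2) := by nlinarith
    have := le_of_mul_le_mul_left h6 hN0
    linarith

lemma mertens_le (t : ℝ) (ht : 1 ≤ t) :
    |∑ p ∈ Nat.primesLE ⌊t⌋₊, Real.log p / p - Real.log t| ≤ 4 := by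
  have h1 : 1 ≤ ⌊t⌋₊ := (Nat.one_le_floor_iff _).2 ht
  have h2 := mertens_nat _ h1
  have h3 : (1 : ℝ) ≤ ⌊t⌋₊ := by exact_mod_cast h1
  have h4 : Real.log ⌊t⌋₊ ≤ Real.log t := Real.log_le_log (by linarith) (Nat.floor_le (by linarith))
  have h5 : Real.log t ≤ Real.log 2 + Real.log ⌊t⌋₊ := by
    rw [← Real.log_mul (by norm_num) (by linarith)]
    apply Real.log_le_log (by linarith)
    linarith [Nat.lt_floor_add_one t]
  have := Real.log_two_lt_d9
  rw [abs_le] at *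
  constructor <;> linarith

lemma mertens_lt (t : ℝ) (ht : 1 ≤ t) :
    |∑ p ∈ (Nat.primesLE ⌊t⌋₊).filter (fun p : ℕ => (p : ℝ) < t), Real.log p / p - Real.log t| ≤ 5 := by
  have h1 := mertens_le t ht
  have h2 := Finset.sum_filter_add_sum_filter_not (Nat.primesLE ⌊t⌋₊) (fun p : ℕ => (p : ℝ) < t)
    (fun p : ℕ => Real.log p / (p : ℝ))
  have h3 : ∑ p ∈ (Nat.primesLE ⌊t⌋₊).filter (fun p : ℕ => ¬ (p : ℝ) < t), Real.log p / (p : ℝ) ≤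
      ∑ p ∈ ({⌊t⌋₊} : Finset ℕ), Real.log p / (p : ℝ) := by
    apply Finset.sum_le_sum_of_subset_of_nonneg
    · intro p hp
      simp only [Finset.mem_filter, not_lt, Nat.mem_primesLE] at hp
      have := Nat.le_floor_iff (a := t) (n := p) (by linarith)
      simp only [Finset.mem_singleton]
      have h4 : ⌊t⌋₊ ≤ p := by
        have := Nat.floor_mono hp.2
        simpa using this
      omega
    · intro i _ _
      exact div_nonneg (Real.log_natCast_nonneg i) (by positivity)
  have h4 : 0 ≤ ∑ p ∈ (Nat.primesLE ⌊t⌋₊).filter (fun p : ℕ => ¬ (p : ℝ) < t), Real.log p / (p : ℝ) :=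
    Finset.sum_nonneg fun i _ => div_nonneg (Real.log_natCast_nonneg i) (by positivity)
  rw [Finset.sum_singleton] at h3
  have h5 : Real.log ⌊t⌋₊ / (⌊t⌋₊ : ℝ) ≤ 1 :=
    div_le_one_of_le₀ (Real.log_le_self (by positivity)) (by positivity)
  rw [abs_le] at *
  constructor <;> linarith

open MeasureTheory in
lemma partial_sum_aux {ι : Type*} (s : Finset ι) (w u : ι → ℝ) (α β L K D B : ℝ) (hαβ : α ≤ β)
    (hu : ∀ i ∈ s, α ≤ u i ∧ u i < β)
    (hS : ∀ v ∈ Set.Icc α β, |∑ i ∈ s.filter (fun i => u i < v), w i - L * (v - α)| ≤ K)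
    (F F' : ℝ → ℝ) (hF : ∀ v ∈ Set.Icc α β, HasDerivAt F (F' v) v)
    (hF' : ContinuousOn F' (Set.Icc α β)) (hB : |F β| ≤ B)
    (hD : ∀ v ∈ Set.Icc α β, |F' v| ≤ D) :
    |∑ i ∈ s, w i * F (u i) - L * ∫ v in α..β, F v| ≤ K * (B + D * (β - α)) := by
  have hββ : β ∈ Set.Icc α β := ⟨hαβ, le_rfl⟩
  have hSβ := hS β hββ
  have hsf : s.filter (fun i => u i < β) = s := Finset.filter_true_of_mem fun i hi => (hu i hi).2
  rw [hsf] at hSβ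
  have hK : 0 ≤ K := (abs_nonneg _).trans hSβ
  have hint : IntegrableOn F' (Set.Ioc α β) :=
    (hF'.integrableOn_Icc).mono_set Set.Ioc_subset_Icc_self
  have hcF : ContinuousOn F (Set.Icc α β) := fun v hv => (hF v hv).continuousAt.continuousWithinAt
  -- each term
  have hterm : ∀ i ∈ s, F (u i) = F β -
      ∫ v in Set.Ioc α β, (Set.Ioi (u i)).indicator F' v := by
    intro i hi
    obtain ⟨h1, h2⟩ := hu i hi
    rw [setIntegral_indicator measurableSet_Ioi]
    have : Set.Ioc α β ∩ Set.Ioi (u i) = Set.Ioc (u i) β := by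
      ext v; simp only [Set.mem_inter_iff, Set.mem_Ioc, Set.mem_Ioi]
      constructor
      · rintro ⟨⟨_, h⟩, h'⟩; exact ⟨h', h⟩
      · rintro ⟨h, h'⟩; exact ⟨⟨by linarith, h'⟩, h⟩
    rw [this, ← intervalIntegral.integral_of_le h2.le,
      intervalIntegral.integral_eq_sub_of_hasDerivAt (f := F)]
    · ring
    · intro v hv
      rw [Set.uIcc_of_le h2.le] at hv
      exact hF v ⟨h1.trans hv.1, hv.2⟩
    · apply ContinuousOn.intervalIntegrable
      rw [Set.uIcc_of_le h2.le]
      exact hF'.mono (Set.Icc_subset_Icc_left h1)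
  have hindint : ∀ i, IntegrableOn ((Set.Ioi (u i)).indicator F') (Set.Ioc α β) :=
    fun i => hint.indicator measurableSet_Ioi
  have hsum : ∑ i ∈ s, w i * F (u i) = F β * ∑ i ∈ s, w i -
      ∫ v in Set.Ioc α β, ∑ i ∈ s, w i * (Set.Ioi (u i)).indicator F' v := by
    rw [integral_finsetSum _ (fun i _ => (hindint i).const_mul (w i)), Finset.mul_sum,
      ← Finset.sum_sub_distrib]
    apply Finset.sum_congr rfl
    intro i hi
    rw [hterm i hi, integral_const_mul]
    ring
  have hparts : ∫ v in α..β, F v = (β - α) * F β - ∫ v in Set.Ioc α β, (v - α) * F' v := by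
    have hd : ∀ v ∈ Set.uIcc α β,
        HasDerivAt (fun v => (v - α) * F v) (F v + (v - α) * F' v) v := by
      intro v hv
      rw [Set.uIcc_of_le hαβ] at hv
      have := ((hasDerivAt_id v).sub_const α).mul (hF v hv)
      exact this.congr_deriv (by simp)
    have hi1 : IntervalIntegrable F volume α β := by
      apply ContinuousOn.intervalIntegrable; rwa [Set.uIcc_of_le hαβ]
    have hi2 : IntervalIntegrable (fun v => (v - α) * F' v) volume α β := by
      apply ContinuousOn.intervalIntegrable; rw [Set.uIcc_of_le hαβ]
      exact ContinuousOn.mul (by fun_prop) hF'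
    have h := intervalIntegral.integral_eq_sub_of_hasDerivAt hd (hi1.add hi2)
    rw [intervalIntegral.integral_add hi1 hi2] at h
    rw [← intervalIntegral.integral_of_le hαβ]
    simp only [sub_self, zero_mul, sub_zero] at h
    linarith
  have hi3 : IntegrableOn (fun v => ∑ i ∈ s, w i * (Set.Ioi (u i)).indicator F' v)
      (Set.Ioc α β) := integrable_finsetSum _ (fun i _ => (hindint i).const_mul (w i))
  have hi4 : IntegrableOn (fun v => L * ((v - α) * F' v)) (Set.Ioc α β) := by
    apply Integrable.const_mul
    exact (ContinuousOn.integrableOn_Icc (ContinuousOn.mul (by fun_prop) hF')).mono_set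
      Set.Ioc_subset_Icc_self
  have hE : ∑ i ∈ s, w i * F (u i) - L * ∫ v in α..β, F v =
      F β * (∑ i ∈ s, w i - L * (β - α)) - ∫ v in Set.Ioc α β,
        (∑ i ∈ s, w i * (Set.Ioi (u i)).indicator F' v - L * ((v - α) * F' v)) := by
    rw [integral_sub hi3 hi4, hsum, hparts, integral_const_mul]
    ring
  have hbd : ‖∫ v in Set.Ioc α β,
        (∑ i ∈ s, w i * (Set.Ioi (u i)).indicator F' v - L * ((v - α) * F' v))‖ ≤
        (K * D) * volume.real (Set.Ioc α β) := by
    apply norm_setIntegral_le_of_norm_le_const (by simp)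
    intro v hv
    have hv' : v ∈ Set.Icc α β := Set.Ioc_subset_Icc_self hv
    have : ∑ i ∈ s, w i * (Set.Ioi (u i)).indicator F' v - L * ((v - α) * F' v) =
        (∑ i ∈ s.filter (fun i => u i < v), w i - L * (v - α)) * F' v := by
      rw [sub_mul (∑ i ∈ s.filter (fun i => u i < v), w i), Finset.sum_mul, Finset.sum_filter]
      congr 1
      · apply Finset.sum_congr rfl
        intro i _
        by_cases h : u i < v <;> simp [Set.indicator, h]
      · ring
    rw [this, Real.norm_eq_abs, abs_mul]
    exact mul_le_mul (hS v hv') (hD v hv') (abs_nonneg _) hK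
  rw [Real.volume_real_Ioc_of_le hαβ, Real.norm_eq_abs] at hbd
  rw [hE]
  have h1 : |F β * (∑ i ∈ s, w i - L * (β - α))| ≤ B * K := by
    rw [abs_mul]
    exact mul_le_mul hB hSβ (abs_nonneg _) ((abs_nonneg _).trans hB)
  calc _ ≤ _ := abs_sub _ _
    _ ≤ B * K + (K * D) * (β - α) := add_le_add h1 hbd
    _ = _ := by ring

lemma sum_primes_Ico (a b : ℝ) (ha : 1 ≤ a) (hab : a ≤ b) (P : Finset ℕ)
    (hP : ∀ p : ℕ, p ∈ P ↔ p.Prime ∧ a ≤ (p : ℝ) ∧ (p : ℝ) < b) :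
    |∑ p ∈ P, Real.log p / p - (Real.log b - Real.log a)| ≤ 10 := by
  have h1 := mertens_lt a ha
  have h2 := mertens_lt b (ha.trans hab)
  have hsub : (Nat.primesLE ⌊a⌋₊).filter (fun p : ℕ => (p : ℝ) < a) ⊆
      (Nat.primesLE ⌊b⌋₊).filter (fun p : ℕ => (p : ℝ) < b) := by
    intro p hp
    simp only [Finset.mem_filter, Nat.mem_primesLE] at hp ⊢
    exact ⟨⟨hp.1.1.trans (Nat.floor_mono hab), hp.1.2⟩, hp.2.trans_le hab⟩
  have hP' : P = (Nat.primesLE ⌊b⌋₊).filter (fun p : ℕ => (p : ℝ) < b) \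
      (Nat.primesLE ⌊a⌋₊).filter (fun p : ℕ => (p : ℝ) < a) := by
    ext p
    simp only [hP, Finset.mem_sdiff, Finset.mem_filter, Nat.mem_primesLE, not_and, not_lt]
    constructor
    · rintro ⟨hp, h1, h2⟩
      exact ⟨⟨⟨Nat.le_floor h2.le, hp⟩, h2⟩, fun _ => h1⟩
    · rintro ⟨⟨⟨_, hp⟩, h2⟩, h3⟩
      refine ⟨hp, ?_, h2⟩
      by_contra hc
      push Not at hc
      exact absurd (h3 ⟨Nat.le_floor hc.le, hp⟩) (not_le.2 hc)
  have h3 := Finset.sum_sdiff (f := fun p : ℕ => Real.log p / (p : ℝ)) hsub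
  rw [← hP'] at h3
  rw [abs_le] at *
  constructor <;> linarith

lemma prime_sum (x a b α β D B : ℝ) (hx : 1 < x) (hα0 : 0 ≤ α) (hαβ : α ≤ β)
    (ha : a = x ^ α) (hb : b = x ^ β) (P : Finset ℕ)
    (hP : ∀ p : ℕ, p ∈ P ↔ p.Prime ∧ a ≤ (p : ℝ) ∧ (p : ℝ) < b)
    (F F' : ℝ → ℝ) (hF : ∀ v ∈ Set.Icc α β, HasDerivAt F (F' v) v)
    (hF' : ContinuousOn F' (Set.Icc α β)) (hB : |F β| ≤ B)
    (hD : ∀ v ∈ Set.Icc α β, |F' v| ≤ D) :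
    |∑ p ∈ P, Real.log p / p * F (Real.log p / Real.log x) - Real.log x * ∫ v in α..β, F v|
      ≤ 10 * (B + D * (β - α)) := by
  have hx0 : 0 < x := by linarith
  have hl : 0 < Real.log x := Real.log_pos hx
  have hlt : ∀ p : ℕ, p.Prime → ∀ v : ℝ, (Real.log p / Real.log x < v ↔ (p : ℝ) < x ^ v) := by
    intro p hp v
    rw [div_lt_iff₀ hl, ← Real.log_rpow hx0, Real.log_lt_log_iff (by exact_mod_cast hp.pos)
      (by positivity)]
  apply partial_sum_aux P (fun p => Real.log p / p) (fun p => Real.log p / Real.log x) α β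
    (Real.log x) 10 D B hαβ
  · intro p hp
    obtain ⟨h1, h2, h3⟩ := (hP p).1 hp
    refine ⟨?_, (hlt p h1 β).2 (hb ▸ h3)⟩
    rw [← not_lt, hlt p h1, not_lt]
    exact ha ▸ h2
  · intro v hv
    have h := sum_primes_Ico a (x ^ v) (ha ▸ Real.one_le_rpow hx.le hα0)
      (ha ▸ Real.rpow_le_rpow_of_exponent_le hx.le hv.1)
      (P.filter (fun p => Real.log p / Real.log x < v)) (by
        intro p
        rw [Finset.mem_filter, hP]
        constructor
        · rintro ⟨⟨h1, h2, h3⟩, h4⟩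
          exact ⟨h1, h2, (hlt p h1 v).1 h4⟩
        · rintro ⟨h1, h2, h3⟩
          refine ⟨⟨h1, h2, h3.trans_le ?_⟩, (hlt p h1 v).2 h3⟩
          exact hb ▸ Real.rpow_le_rpow_of_exponent_le hx.le hv.2)
    rw [ha, Real.log_rpow hx0, Real.log_rpow hx0] at h
    convert h using 2
    ring
  · exact hF
  · exact hF'
  · exact hB
  · exact hD

lemma inner_integral (c : ℝ) (hc0 : 0 < c) (hc : c ≤ 1 / 3) :
    ∫ v in (1 / 3 : ℝ)..((1 - c) / 2), 1 / (v * (1 - c - v)) = Real.log (2 - 3 * c) / (1 - c) := by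
  have hle : (1 / 3 : ℝ) ≤ (1 - c) / 2 := by linarith
  have hd : ∀ v ∈ Set.uIcc (1 / 3 : ℝ) ((1 - c) / 2),
      HasDerivAt (fun v => (Real.log v - Real.log (1 - c - v)) / (1 - c))
        (1 / (v * (1 - c - v))) v := by
    intro v hv
    rw [Set.uIcc_of_le hle] at hv
    obtain ⟨h1, h2⟩ := hv
    have hv0 : v ≠ 0 := by linarith
    have hv1 : 1 - c - v ≠ 0 := by linarith
    have hc1 : 1 - c ≠ 0 := by linarith
    have := ((Real.hasDerivAt_log hv0).sub
      (((hasDerivAt_id v).const_sub (1 - c)).log hv1)).div_const (1 - c)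
    refine this.congr_deriv ?_
    simp only [id]
    field_simp
    ring
  rw [intervalIntegral.integral_eq_sub_of_hasDerivAt hd]
  · have e1 : 1 - c - (1 - c) / 2 = (1 - c) / 2 := by ring
    have e2 : Real.log (2 - 3 * c) = Real.log (1 - c - 1 / 3) - Real.log (1 / 3) := by
      rw [← Real.log_div (by linarith) (by norm_num)]
      congr 1; ring
    rw [e1, e2]
    ring
  · apply ContinuousOn.intervalIntegrable
    rw [Set.uIcc_of_le hle]
    apply ContinuousOn.div (by fun_prop) (by fun_prop)
    rintro v ⟨h1, h2⟩
    have : 0 < v * (1 - c - v) := mul_pos (by linarith) (by linarith)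
    exact this.ne'

lemma inner_prime_sum (x c : ℝ) (q : ℕ) (hx : 1 < x) (hc0 : 0 < c) (hc : c ≤ 1 / 3)
    (hq : (q : ℝ) = x ^ c) (P : Finset ℕ)
    (hP : ∀ p : ℕ, p ∈ P ↔ p.Prime ∧ x ^ ((1 : ℝ) / 3) ≤ (p : ℝ) ∧
      (p : ℝ) < (x / (q : ℝ)) ^ ((1 : ℝ) / 2)) :
    |∑ p ∈ P, 1 / ((p : ℝ) * Real.log (x / ((q : ℝ) * (p : ℝ)))) -
      Real.log (2 - 3 * c) / (1 - c) / Real.log x| ≤ 360 / (Real.log x) ^ 2 := by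
  have hx0 : 0 < x := by linarith
  have hl : 0 < Real.log x := Real.log_pos hx
  have hle : (1 / 3 : ℝ) ≤ (1 - c) / 2 := by linarith
  have hb : (x / (q : ℝ)) ^ ((1 : ℝ) / 2) = x ^ ((1 - c) / 2) := by
    rw [hq]
    nth_rewrite 1 [← Real.rpow_one x]
    rw [← Real.rpow_sub hx0, ← Real.rpow_mul hx0.le]
    congr 1; ring
  have hpos : ∀ v ∈ Set.Icc (1 / 3 : ℝ) ((1 - c) / 2), 1 / 9 ≤ v * (1 - c - v) := by
    rintro v ⟨h1, h2⟩
    nlinarith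
  have key := prime_sum x _ _ (1 / 3) ((1 - c) / 2) 27 9 hx (by norm_num) hle rfl hb P hP
    (fun v => 1 / (v * (1 - c - v))) (fun v => -(1 - c - 2 * v) / (v * (1 - c - v)) ^ 2)
    (by
      intro v hv
      have h := hpos v hv
      have hne : v * (1 - c - v) ≠ 0 := by linarith
      have hd : HasDerivAt (fun v => v * (1 - c - v)) (1 - c - 2 * v) v := by
        have := (hasDerivAt_id v).mul ((hasDerivAt_id v).const_sub (1 - c))
        refine this.congr_deriv ?_
        simp only [id]; ring
      have := hd.inv hne
      simpa only [one_div] using! this)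
    (by
      apply ContinuousOn.div (by fun_prop) (by fun_prop)
      intro v hv
      have h := hpos v hv
      have : 0 < v * (1 - c - v) := by linarith
      positivity)
    (by
      have h := hpos _ ⟨hle, le_rfl⟩
      rw [abs_of_nonneg (by positivity)]
      rw [div_le_iff₀ (by linarith)]
      linarith)
    (by
      intro v hv
      have h := hpos v hv
      rw [abs_div, abs_neg, abs_of_nonneg (by linarith [hv.2] : 0 ≤ 1 - c - 2 * v),
        abs_of_nonneg (by positivity), div_le_iff₀ (by nlinarith)]
      have h2 : 1 / 81 ≤ (v * (1 - c - v)) ^ 2 := by nlinarith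
      linarith [hv.1])
  rw [inner_integral c hc0 hc] at key
  have hsum : ∑ p ∈ P, 1 / ((p : ℝ) * Real.log (x / ((q : ℝ) * (p : ℝ)))) =
      (∑ p ∈ P, Real.log p / p * (fun v => 1 / (v * (1 - c - v))) (Real.log p / Real.log x)) /
        Real.log x ^ 2 := by
    rw [Finset.sum_div]
    apply Finset.sum_congr rfl
    intro p hp
    have hpp := ((hP p).1 hp).1
    have hp0 : (0 : ℝ) < p := by exact_mod_cast hpp.pos
    have hlp : 0 < Real.log p := Real.log_pos (by exact_mod_cast hpp.one_lt)
    have hq0 : (0 : ℝ) < q := by rw [hq]; positivity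
    rw [Real.log_div hx0.ne' (by positivity), Real.log_mul hq0.ne' hp0.ne', hq, Real.log_rpow hx0]
    have e : Real.log x - (c * Real.log x + Real.log p) =
      Real.log x * (1 - c - Real.log p / Real.log x) := by field_simp; ring
    rw [e]
    by_cases hz : 1 - c - Real.log p / Real.log x = 0
    · simp [hz]
    · field_simp
  rw [hsum]
  set S := ∑ p ∈ P, Real.log p / p * (fun v => 1 / (v * (1 - c - v))) (Real.log p / Real.log x)
  have e : S / Real.log x ^ 2 - Real.log (2 - 3 * c) / (1 - c) / Real.log x =
      (S - Real.log x * (Real.log (2 - 3 * c) / (1 - c))) / Real.log x ^ 2 := by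
    field_simp
  rw [e, abs_div, abs_of_nonneg (by positivity : 0 ≤ Real.log x ^ 2)]
  gcongr
  linarith

lemma outer_sum (δ : ℝ) (hδ0 : 0 < δ) (hδ1 : δ < 1 / 3) :
    ∃ E : ℝ, 0 ≤ E ∧ ∀ x : ℝ, 1 < x → ∀ P : Finset ℕ,
      (∀ p : ℕ, p ∈ P ↔ p.Prime ∧ x ^ δ ≤ (p : ℝ) ∧ (p : ℝ) < x ^ ((1 : ℝ) / 3)) →
      |∑ p ∈ P, Real.log p / p * (fun v => Real.log (2 - 3 * v) / (v * (1 - v)))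
          (Real.log p / Real.log x) -
        Real.log x * ∫ v in δ..(1 / 3 : ℝ), Real.log (2 - 3 * v) / (v * (1 - v))| ≤ E := by
  let F' : ℝ → ℝ := fun v =>
    (-3 / (2 - 3 * v) * (v * (1 - v)) - Real.log (2 - 3 * v) * (1 - 2 * v)) / (v * (1 - v)) ^ 2
  have hc : ContinuousOn F' (Set.Icc δ (1 / 3)) := by
    have h1 : ∀ v ∈ Set.Icc δ (1 / 3), 2 - 3 * v ≠ 0 := by
      rintro v ⟨_, h2⟩; linarith
    apply ContinuousOn.div
    · apply ContinuousOn.sub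
      · exact (ContinuousOn.div (by fun_prop) (by fun_prop) h1).mul (by fun_prop)
      · exact (ContinuousOn.log (by fun_prop) h1).mul (by fun_prop)
    · fun_prop
    · rintro v ⟨h2, h3⟩
      have : 0 < v * (1 - v) := mul_pos (by linarith) (by linarith)
      positivity
  obtain ⟨D, hD⟩ := isCompact_Icc.exists_bound_of_continuousOn hc
  have hD0 : 0 ≤ D := (norm_nonneg _).trans (hD δ ⟨le_rfl, hδ1.le⟩)
  refine ⟨10 * (|(fun v => Real.log (2 - 3 * v) / (v * (1 - v))) (1 / 3 : ℝ)| + D * (1 / 3 - δ)),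
    ?_, ?_⟩
  · have : 0 ≤ D * (1 / 3 - δ) := mul_nonneg hD0 (by linarith)
    positivity
  intro x hx P hP
  apply prime_sum x _ _ δ (1 / 3) D _ hx hδ0.le hδ1.le rfl rfl P hP (fun v => Real.log (2 - 3 * v) / (v * (1 - v))) F' _ hc le_rfl
    (fun v hv => hD v hv)
  rintro v ⟨h1, h2⟩
  have hne : v * (1 - v) ≠ 0 := (mul_pos (by linarith : 0 < v) (by linarith)).ne'
  have hd1 : HasDerivAt (fun v => v * (1 - v)) (1 - 2 * v) v := by
    refine ((hasDerivAt_id v).mul ((hasDerivAt_id v).const_sub 1)).congr_deriv ?_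
    simp only [id]; ring
  have hd2 : HasDerivAt (fun v => Real.log (2 - 3 * v)) (-3 / (2 - 3 * v)) v := by
    have h3 : HasDerivAt (fun v : ℝ => 2 - 3 * v) (-3) v := by
      refine (((hasDerivAt_id v).const_mul 3).const_sub 2).congr_deriv ?_
      simp
    exact h3.log (by linarith)
  exact hd2.div hd1 hne

theorem stmt15 (δ : ℝ) (hδ0 : 0 < δ) (hδ1 : δ < 1 / 3)
    (Cδ : ℝ)
    (hCδ : Cδ = ∫ β in δ..(1 / 3 : ℝ), Real.log (2 - 3 * β) / (β * (1 - β))) :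
    ∃ C : ℝ, 0 < C ∧ ∃ x₀ : ℝ, 3 ≤ x₀ ∧ ∀ x : ℝ, x₀ ≤ x →
      |doubleSum δ x - Cδ / Real.log x| ≤ C / (Real.log x) ^ 2 := by
  obtain ⟨E, hE0, hE⟩ := outer_sum δ hδ0 hδ1
  refine ⟨360 * (11 / δ) + E, by positivity, 3, le_rfl, ?_⟩
  intro x hx3
  have hx : 1 < x := by linarith
  have hx0 : 0 < x := by linarith
  have hl1 : 1 ≤ Real.log x := by
    rw [Real.le_log_iff_exp_le hx0]
    linarith [Real.exp_one_lt_d9]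
  have hl : 0 < Real.log x := by linarith
  unfold doubleSum
  set P := (Finset.range (⌊x⌋₊ + 1)).filter
      (fun p : ℕ => p.Prime ∧ x ^ δ ≤ (p : ℝ) ∧ (p : ℝ) < x ^ ((1 : ℝ) / 3)) with hPdef
  have hP : ∀ p : ℕ, p ∈ P ↔ p.Prime ∧ x ^ δ ≤ (p : ℝ) ∧ (p : ℝ) < x ^ ((1 : ℝ) / 3) := by
    intro p
    rw [hPdef, Finset.mem_filter]
    refine ⟨fun h => h.2, fun h => ⟨?_, h⟩⟩
    rw [Finset.mem_range, Nat.lt_succ_iff]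
    apply Nat.le_floor
    have h1 : x ^ ((1 : ℝ) / 3) ≤ x ^ (1 : ℝ) :=
      Real.rpow_le_rpow_of_exponent_le hx.le (by norm_num)
    rw [Real.rpow_one] at h1
    linarith [h.2.2]
  have hout := hE x hx P hP
  rw [← hCδ] at hout
  -- sum of reciprocals
  have hrange : ∀ p ∈ P, δ ≤ Real.log p / Real.log x ∧ Real.log p / Real.log x ≤ 1 / 3 ∧
      (p : ℝ) = x ^ (Real.log p / Real.log x) := by
    intro p hp
    obtain ⟨h1, h2, h3⟩ := (hP p).1 hp
    have hp0 : (0 : ℝ) < p := by exact_mod_cast h1.pos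
    refine ⟨?_, ?_, ?_⟩
    · rw [le_div_iff₀ hl, ← Real.log_rpow hx0]
      exact Real.log_le_log (by positivity) h2
    · rw [div_le_iff₀ hl, ← Real.log_rpow hx0]
      exact Real.log_le_log hp0 h3.le
    · rw [Real.rpow_def_of_pos hx0, mul_div_cancel₀ _ hl.ne', Real.exp_log hp0]
  have hrec : ∑ p ∈ P, 1 / (p : ℝ) ≤ 11 / δ := by
    have h1 := sum_primes_Ico (x ^ δ) (x ^ ((1 : ℝ) / 3)) (Real.one_le_rpow hx.le hδ0.le)
      (Real.rpow_le_rpow_of_exponent_le hx.le hδ1.le) P hP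
    rw [Real.log_rpow hx0, Real.log_rpow hx0] at h1
    have h2 := (abs_le.1 h1).2
    have h3 : ∑ p ∈ P, 1 / (p : ℝ) ≤ ∑ p ∈ P, (Real.log p / p) * (1 / (δ * Real.log x)) := by
      apply Finset.sum_le_sum
      intro p hp
      have h4 := (hrange p hp).1
      rw [le_div_iff₀ hl] at h4
      have h5 : 1 ≤ Real.log p * (1 / (δ * Real.log x)) := by
        rw [mul_one_div, le_div_iff₀ (by positivity)]; linarith
      have h6 : (0 : ℝ) ≤ 1 / p := by positivity
      calc 1 / (p : ℝ) ≤ 1 / (p : ℝ) * (Real.log p * (1 / (δ * Real.log x))) :=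
            le_mul_of_one_le_right h6 h5
        _ = _ := by ring
    rw [← Finset.sum_mul] at h3
    have h4 : ∑ p ∈ P, Real.log p / (p : ℝ) ≤ 11 * Real.log x := by nlinarith
    calc _ ≤ _ := h3
      _ ≤ (11 * Real.log x) * (1 / (δ * Real.log x)) := by gcongr
      _ = _ := by field_simp
  -- main comparison
  have hmain : ∑ p ∈ P, (1 / (p : ℝ)) * (Real.log (2 - 3 * (Real.log p / Real.log x)) /
      (1 - Real.log p / Real.log x) / Real.log x) =
      (∑ p ∈ P, Real.log p / p * (fun v => Real.log (2 - 3 * v) / (v * (1 - v)))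
          (Real.log p / Real.log x)) / Real.log x ^ 2 := by
    rw [Finset.sum_div]
    apply Finset.sum_congr rfl
    intro p hp
    have h1 := ((hP p).1 hp).1
    have hlp : 0 < Real.log p := Real.log_pos (by exact_mod_cast h1.one_lt)
    have hp0 : (0 : ℝ) < p := by exact_mod_cast h1.pos
    obtain ⟨_, h3, _⟩ := hrange p hp
    set c := Real.log p / Real.log x with hc
    have hlc : Real.log p = c * Real.log x := by rw [hc]; field_simp
    have hc0 : 0 < c := by positivity
    have hc1 : 1 - c ≠ 0 := by linarith
    simp only []
    rw [hlc]
    field_simp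
  set S := ∑ p ∈ P, Real.log p / p * (fun v => Real.log (2 - 3 * v) / (v * (1 - v)))
          (Real.log p / Real.log x) with hS
  have hA : |S / Real.log x ^ 2 - Cδ / Real.log x| ≤ E / Real.log x ^ 2 := by
    have e : S / Real.log x ^ 2 - Cδ / Real.log x = (S - Real.log x * Cδ) / Real.log x ^ 2 := by
      field_simp
    rw [e, abs_div, abs_of_nonneg (by positivity : 0 ≤ Real.log x ^ 2)]
    gcongr
  refine (abs_sub_le _ (S / Real.log x ^ 2) _).trans ?_
  rw [add_div]
  refine add_le_add ?_ hA
  rw [← hmain, ← Finset.sum_sub_distrib]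
  refine (Finset.abs_sum_le_sum_abs _ _).trans ?_
  calc _ ≤ ∑ p ∈ P, (1 / (p : ℝ)) * (360 / Real.log x ^ 2) := by
        apply Finset.sum_le_sum
        intro p hp
        obtain ⟨h1, h2, h3⟩ := hrange p hp
        rw [← mul_sub, abs_mul, abs_of_nonneg (by positivity : (0 : ℝ) ≤ 1 / p)]
        refine mul_le_mul_of_nonneg_left ?_ (by positivity)
        apply inner_prime_sum x _ p hx (by linarith) h2 h3
        intro r
        rw [Finset.mem_filter]
        refine ⟨fun h => h.2, fun h => ⟨?_, h⟩⟩
        rw [Finset.mem_range, Nat.lt_succ_iff]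
        apply Nat.le_floor
        have hp1 : (1 : ℝ) ≤ p := by exact_mod_cast ((hP p).1 hp).1.one_le
        have h4 : (x / (p : ℝ)) ^ ((1 : ℝ) / 2) ≤ x ^ ((1 : ℝ) / 2) :=
          Real.rpow_le_rpow (by positivity) (div_le_self hx0.le hp1) (by norm_num)
        have h5 : x ^ ((1 : ℝ) / 2) ≤ x ^ (1 : ℝ) :=
          Real.rpow_le_rpow_of_exponent_le hx.le (by norm_num)
        rw [Real.rpow_one] at h5
        linarith [h.2.2]
    _ = (∑ p ∈ P, 1 / (p : ℝ)) * (360 / Real.log x ^ 2) := by rw [Finset.sum_mul]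
    _ ≤ 11 / δ * (360 / Real.log x ^ 2) := by gcongr
    _ = _ := by ring
end
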